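/- arXiv:1805.06520 — 6 statements merged into one kernel-verified Lean document; each statement's English description precedes it below -/
import Mathlib

section
/- Let α and β be real numbers with β ≥ 0 and 0 < 2−α < β. Then there exists a constant C (depending only on α and β) such that for every X ∈ ℝ: ∫_0^{+∞} (1+|X−τ|)^{−β} τ^{1−α} dτ ≤ C·(1+|X|)^{2−α−min{β,1}}·L(X), where L(X) = log(2+|X|) if β = 1 and L(X) = 1 if β ≠ 1. -/
open MeasureTheory Real

/-- Growth of the primitive of `(1 + v) ^ (-β)`, with a logarithm exactly when `β = 1`. -/
lemma exists_intervalIntegral_one_add_rpow_neg_le (β : ℝ) :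
    ∃ K : ℝ, 0 ≤ K ∧ ∀ t : ℝ, 0 ≤ t →
      (∫ v in (0 : ℝ)..(3 * (1 + t)), (1 + v) ^ (-β)) ≤
        K * (1 + t) ^ (1 - min β 1) * (if β = 1 then log (2 + t) else 1) := by
  have shift (t : ℝ) : (∫ v in (0 : ℝ)..(3 * (1 + t)), (1 + v) ^ (-β)) =
      ∫ v in (1 : ℝ)..(1 + 3 * (1 + t)), v ^ (-β) := by
    simpa using intervalIntegral.integral_comp_add_left
      (a := 0) (b := 3 * (1 + t)) (fun v : ℝ => v ^ (-β)) 1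
  have zero_notMem (t : ℝ) (ht : 0 ≤ t) : (0 : ℝ) ∉ Set.uIcc 1 (1 + 3 * (1 + t)) := by
    rw [Set.uIcc_of_le (by linarith)]
    rintro ⟨h, -⟩
    linarith
  rcases lt_trichotomy β 1 with h | rfl | h
  · refine ⟨4 ^ (1 - β) / (1 - β), div_nonneg (by positivity) (by linarith), fun t ht => ?_⟩
    rw [shift, integral_rpow (Or.inl (by linarith)), if_neg h.ne, min_eq_left h.le, one_rpow,
      mul_one, div_mul_eq_mul_div, ← mul_rpow (by norm_num) (by linarith),
      show -β + 1 = 1 - β by ring]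
    have hpow : (1 + 3 * (1 + t)) ^ (1 - β) ≤ (4 * (1 + t)) ^ (1 - β) :=
      rpow_le_rpow (by linarith) (by linarith) (by linarith)
    exact div_le_div_of_nonneg_right (by linarith) (by linarith)
  · refine ⟨2, by norm_num, fun t ht => ?_⟩
    rw [shift]
    simp only [rpow_neg_one, integral_inv (zero_notMem t ht), div_one, min_self, sub_self,
      rpow_zero, mul_one, if_true]
    rw [show (2 : ℝ) * log (2 + t) = log ((2 + t) ^ 2) by simp]
    exact log_le_log (by linarith) (by nlinarith)
  · refine ⟨1 / (β - 1), div_nonneg zero_le_one (by linarith), fun t ht => ?_⟩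
    rw [shift, integral_rpow (Or.inr ⟨by linarith, zero_notMem t ht⟩), if_neg h.ne',
      min_eq_right h.le, one_rpow, sub_self, rpow_zero, mul_one, mul_one,
      show -β + 1 = -(β - 1) by ring, div_neg, ← neg_div, neg_sub]
    have hpow : 0 ≤ (1 + 3 * (1 + t)) ^ (-(β - 1)) := rpow_nonneg (by linarith) _
    exact div_le_div_of_nonneg_right (by linarith) (by linarith)

/-- The kernel `(1 + |X - τ|) ^ (-β)` cut off at distance `M` from `X`. -/
noncomputable def truncatedKernel (β M X τ : ℝ) : ℝ :=
  (Set.Iic M).indicator (fun v : ℝ => (1 + v) ^ (-β)) |X - τ|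

lemma truncatedKernel_nonneg (β M X τ : ℝ) : 0 ≤ truncatedKernel β M X τ := by
  unfold truncatedKernel Set.indicator
  split_ifs <;> positivity

lemma integrable_truncatedKernel (β M X : ℝ) : Integrable (truncatedKernel β M X) := by
  have key : Integrable
      (fun u : ℝ => (Set.Iic M).indicator (fun v : ℝ => (1 + v) ^ (-β)) |u|) := by
    have hcont : Continuous fun u : ℝ => (1 + |u|) ^ (-β) :=
      Continuous.rpow_const (by fun_prop) fun u => Or.inl (by positivity)
    refine ((integrable_indicator_iff measurableSet_Icc).2
      (hcont.integrableOn_Icc (a := -M) (b := M))).congr (Filter.Eventually.of_forall fun u => ?_)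
    simp only [Set.indicator, Set.mem_Icc, Set.mem_Iic, abs_le]
  exact key.comp_sub_left X

lemma integral_truncatedKernel (β X : ℝ) {M : ℝ} (hM : 0 ≤ M) :
    ∫ τ, truncatedKernel β M X τ = 2 * ∫ v in (0 : ℝ)..M, (1 + v) ^ (-β) := by
  unfold truncatedKernel
  rw [integral_sub_left_eq_self
    (fun u : ℝ => (Set.Iic M).indicator (fun v : ℝ => (1 + v) ^ (-β)) |u|) volume X,
    integral_comp_abs (f := (Set.Iic M).indicator (fun v : ℝ => (1 + v) ^ (-β))),
    setIntegral_indicator measurableSet_Iic, Set.Ioi_inter_Iic,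
    intervalIntegral.integral_of_le hM]

/-- Between `R / 2` and `2 * R` all powers are comparable with that of `R`. -/
lemma rpow_le_of_mem_Icc {R τ : ℝ} (s : ℝ) (hR : 0 < R) (h₁ : R / 2 ≤ τ) (h₂ : τ ≤ 2 * R) :
    τ ^ s ≤ 2 ^ |s| * R ^ s := by
  rcases le_total 0 s with hs | hs
  · rw [abs_of_nonneg hs, ← mul_rpow (by norm_num) hR.le]
    exact rpow_le_rpow (by linarith) h₂ hs
  · calc τ ^ s ≤ (R / 2) ^ s := rpow_le_rpow_of_nonpos (by linarith) h₁ hs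
      _ = 2 ^ |s| * R ^ s := by
        rw [abs_of_nonpos hs, div_rpow hR.le (by norm_num), rpow_neg (by norm_num)]
        ring

/-- A dominating function for `(1 + |X - τ|) ^ (-β) * τ ^ (a - 1)`, splitting the half-line at
`R / 2` and `2 * R` with `R = 1 + |X|`. -/
lemma one_add_abs_sub_rpow_mul_rpow_le {a β X τ : ℝ} (hβ : 0 ≤ β) (hτ : 0 < τ) :
    (1 + |X - τ|) ^ (-β) * τ ^ (a - 1) ≤
      (Set.Ioc 0 ((1 + |X|) / 2)).indicator
          (fun τ => ((1 + |X|) / 2) ^ (-β) * τ ^ (a - 1)) τ +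
        2 ^ |a - 1| * (1 + |X|) ^ (a - 1) * truncatedKernel β (3 * (1 + |X|)) X τ +
        (Set.Ioi (2 * (1 + |X|))).indicator (fun τ => 2 ^ β * τ ^ (a - 1 - β)) τ := by
  have hX : 0 ≤ |X| := abs_nonneg X
  have hK := truncatedKernel_nonneg β (3 * (1 + |X|)) X τ
  have hB : 0 ≤ 2 ^ |a - 1| * (1 + |X|) ^ (a - 1) * truncatedKernel β (3 * (1 + |X|)) X τ := by
    positivity
  have hA : 0 ≤ (Set.Ioc 0 ((1 + |X|) / 2)).indicator
      (fun τ => ((1 + |X|) / 2) ^ (-β) * τ ^ (a - 1)) τ :=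
    Set.indicator_nonneg (fun x hx => by have := hx.1; positivity) _
  have hC : 0 ≤ (Set.Ioi (2 * (1 + |X|))).indicator (fun τ => 2 ^ β * τ ^ (a - 1 - β)) τ :=
    Set.indicator_nonneg (fun x hx => by
      have : 0 < x := lt_trans (by positivity) (Set.mem_Ioi.1 hx)
      positivity) _
  rcases le_or_gt τ ((1 + |X|) / 2) with hnear | hnear
  · rw [Set.indicator_of_mem (Set.mem_Ioc.2 ⟨hτ, hnear⟩)] at hA ⊢
    have hdist : (1 + |X|) / 2 ≤ 1 + |X - τ| := by
      have := abs_sub_abs_le_abs_sub X τ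
      rw [abs_of_pos hτ] at this
      linarith
    have := mul_le_mul_of_nonneg_right
      (rpow_le_rpow_of_nonpos (by positivity) hdist (neg_nonpos.2 hβ))
      (rpow_nonneg hτ.le (a - 1))
    linarith
  rcases le_or_gt τ (2 * (1 + |X|)) with hfar | hfar
  · have hdist : |X - τ| ≤ 3 * (1 + |X|) := by
      have := abs_sub X τ
      rw [abs_of_pos hτ] at this
      linarith
    have hker : truncatedKernel β (3 * (1 + |X|)) X τ = (1 + |X - τ|) ^ (-β) :=
      Set.indicator_of_mem (Set.mem_Iic.2 hdist) _
    rw [hker] at hK hB ⊢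
    have := mul_le_mul_of_nonneg_left
      (rpow_le_of_mem_Icc (a - 1) (by positivity) hnear.le hfar) hK
    linarith
  · rw [Set.indicator_of_mem (Set.mem_Ioi.2 hfar)] at hC ⊢
    have hdist : τ / 2 ≤ 1 + |X - τ| := by
      have := abs_sub_abs_le_abs_sub τ X
      rw [abs_of_pos hτ, abs_sub_comm] at this
      linarith
    have hle := mul_le_mul_of_nonneg_right
      (rpow_le_rpow_of_nonpos (by positivity) hdist (neg_nonpos.2 hβ))
      (rpow_nonneg hτ.le (a - 1))
    have heq : (τ / 2) ^ (-β) * τ ^ (a - 1) = 2 ^ β * τ ^ (a - 1 - β) := by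
      rw [div_rpow hτ.le (by norm_num), rpow_neg (zero_le_two : (0 : ℝ) ≤ 2),
        sub_eq_add_neg (a - 1), rpow_add hτ, div_inv_eq_mul]
      ring
    linarith

/-- The three contributions to the integral: near the origin, comparable with `X`, and at
infinity. -/
lemma integral_one_add_abs_sub_rpow_mul_rpow_le {a β : ℝ} (ha : 0 < a) (hβ : a < β) (X : ℝ) :
    (∫ τ in Set.Ioi (0 : ℝ), (1 + |X - τ|) ^ (-β) * τ ^ (a - 1)) ≤
      ((1 + |X|) / 2) ^ (-β) * (((1 + |X|) / 2) ^ a / a) +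
        2 ^ |a - 1| * (1 + |X|) ^ (a - 1) *
          (2 * ∫ v in (0 : ℝ)..(3 * (1 + |X|)), (1 + v) ^ (-β)) +
        2 ^ β * ((2 * (1 + |X|)) ^ (a - β) / (β - a)) := by
  have hR : 0 < 1 + |X| := by positivity
  have intA : IntegrableOn (fun τ : ℝ => ((1 + |X|) / 2) ^ (-β) * τ ^ (a - 1))
      (Set.Ioc 0 ((1 + |X|) / 2)) := by
    rw [← intervalIntegrable_iff_integrableOn_Ioc_of_le (by positivity)]
    exact (intervalIntegral.intervalIntegrable_rpow' (by linarith)).const_mul _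
  have intC : IntegrableOn (fun τ : ℝ => 2 ^ β * τ ^ (a - 1 - β)) (Set.Ioi (2 * (1 + |X|))) :=
    (integrableOn_Ioi_rpow_of_lt (by linarith) (by positivity)).const_mul _
  have intA' := (integrable_indicator_iff measurableSet_Ioc).2 intA
  have intC' := (integrable_indicator_iff measurableSet_Ioi).2 intC
  have intB' := (integrable_truncatedKernel β (3 * (1 + |X|)) X).const_mul
    (2 ^ |a - 1| * (1 + |X|) ^ (a - 1))
  rw [← integral_indicator measurableSet_Ioi]
  calc _ ≤ ∫ τ, ((Set.Ioc 0 ((1 + |X|) / 2)).indicator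
          (fun τ => ((1 + |X|) / 2) ^ (-β) * τ ^ (a - 1)) τ +
        2 ^ |a - 1| * (1 + |X|) ^ (a - 1) * truncatedKernel β (3 * (1 + |X|)) X τ +
        (Set.Ioi (2 * (1 + |X|))).indicator (fun τ => 2 ^ β * τ ^ (a - 1 - β)) τ) := by
        refine integral_mono_of_nonneg (Filter.Eventually.of_forall fun τ => ?_)
          ((intA'.add intB').add intC') (Filter.Eventually.of_forall fun τ => ?_)
        · exact Set.indicator_nonneg (fun x hx => by
            have : 0 < x := hx
            positivity) τ
        · refine Set.indicator_apply_le' (fun hx => ?_) (fun _ => ?_)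
          · exact one_add_abs_sub_rpow_mul_rpow_le (ha.trans hβ).le hx
          · have hK := truncatedKernel_nonneg β (3 * (1 + |X|)) X τ
            refine add_nonneg (add_nonneg ?_ (by positivity)) ?_
            · exact Set.indicator_nonneg (fun y hy => by have := hy.1; positivity) τ
            · exact Set.indicator_nonneg (fun y hy => by
                have : 0 < y := lt_trans (by positivity) (Set.mem_Ioi.1 hy)
                positivity) τ
    _ = _ := by
        rw [integral_add (by exact intA'.add intB') intC', integral_add intA' intB',
          integral_indicator measurableSet_Ioc, integral_indicator measurableSet_Ioi,
          integral_const_mul, integral_const_mul, integral_const_mul,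
          integral_truncatedKernel β X (by positivity),
          integral_Ioi_rpow_of_lt (by linarith) (by positivity),
          ← intervalIntegral.integral_of_le (by positivity),
          integral_rpow (Or.inl (by linarith)), sub_add_cancel, zero_rpow ha.ne', sub_zero,
          show a - 1 - β + 1 = -(β - a) by ring, neg_div_neg_eq, neg_sub]

/-- Lemma (crucial integral estimate, part 1): if `β ≥ 0` and `0 < 2−α < β`, then
`∫_0^∞ (1+|X−τ|)^{−β} τ^{1−α} dτ ≤ C (1+|X|)^{2−α−min{β,1}} log^{δ_{1,β}}(2+|X|)`. -/
theorem integral_estimate_one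
    (α β : ℝ) (hβ : 0 ≤ β) (h1 : 0 < 2 - α) (h2 : 2 - α < β) :
    ∃ C : ℝ, ∀ X : ℝ,
      (∫ τ in Set.Ioi (0 : ℝ), (1 + |X - τ|) ^ (-β) * τ ^ (1 - α))
        ≤ C * (1 + |X|) ^ (2 - α - min β 1) *
          (if β = 1 then Real.log (2 + |X|) else 1) := by
  obtain ⟨K, hK, hbound⟩ := exists_intervalIntegral_one_add_rpow_neg_le β
  obtain ⟨a, rfl⟩ : ∃ a, α = 2 - a := ⟨2 - α, by ring⟩
  simp only [sub_sub_cancel] at h1 h2 ⊢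
  have hβa : 0 < β - a := by linarith
  refine ⟨2 * ((1 / 2) ^ (a - β) / a + 2 ^ β * (2 ^ (a - β) / (β - a))) +
    2 ^ |a - 1| * 2 * K, fun X => ?_⟩
  have hR : 0 < 1 + |X| := by positivity
  rw [show (1 : ℝ) - (2 - a) = a - 1 by ring]
  refine (integral_one_add_abs_sub_rpow_mul_rpow_le h1 h2 X).trans ?_
  have hmid := hbound |X| (abs_nonneg X)
  set L : ℝ := if β = 1 then log (2 + |X|) else 1 with hLdef
  have hL : 1 / 2 ≤ L := by
    rw [hLdef]
    split_ifs
    · have := log_le_log (by norm_num : (0 : ℝ) < 2) (by linarith [abs_nonneg X] : 2 ≤ 2 + |X|)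
      linarith [log_two_gt_d9]
    · norm_num
  have hpow : (1 + |X|) ^ (a - β) ≤ 2 * ((1 + |X|) ^ (a - min β 1) * L) := by
    have hle : (1 + |X|) ^ (a - β) ≤ (1 + |X|) ^ (a - min β 1) :=
      rpow_le_rpow_of_exponent_le (by linarith [abs_nonneg X]) (by linarith [min_le_left β 1])
    have := mul_le_mul_of_nonneg_left hL (rpow_nonneg hR.le (a - min β 1))
    linarith
  have hnear : ((1 + |X|) / 2) ^ (-β) * (((1 + |X|) / 2) ^ a / a) =
      (1 / 2) ^ (a - β) / a * (1 + |X|) ^ (a - β) := by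
    rw [mul_div_assoc', ← rpow_add (by positivity), show -β + a = a - β by ring,
      show (1 + |X|) / 2 = 1 / 2 * (1 + |X|) by ring, mul_rpow (by norm_num) hR.le]
    ring
  have hfar : 2 ^ β * ((2 * (1 + |X|)) ^ (a - β) / (β - a)) =
      2 ^ β * (2 ^ (a - β) / (β - a)) * (1 + |X|) ^ (a - β) := by
    rw [mul_rpow (by norm_num) hR.le]
    ring
  have hexp : (1 + |X|) ^ (a - min β 1) = (1 + |X|) ^ (a - 1) * (1 + |X|) ^ (1 - min β 1) := by
    rw [← rpow_add hR]
    congr 1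
    ring
  rw [hnear, hfar]
  calc _ = ((1 / 2) ^ (a - β) / a + 2 ^ β * (2 ^ (a - β) / (β - a))) * (1 + |X|) ^ (a - β) +
        2 ^ |a - 1| * (1 + |X|) ^ (a - 1) * 2 *
          ∫ v in (0 : ℝ)..(3 * (1 + |X|)), (1 + v) ^ (-β) := by ring
    _ ≤ ((1 / 2) ^ (a - β) / a + 2 ^ β * (2 ^ (a - β) / (β - a))) *
          (2 * ((1 + |X|) ^ (a - min β 1) * L)) +
        2 ^ |a - 1| * (1 + |X|) ^ (a - 1) * 2 * (K * (1 + |X|) ^ (1 - min β 1) * L) := by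
        gcongr
    _ = _ := by
        rw [hexp]
        ring
end

section
/- Let α < 2 and let β be any real number. Then there exists a constant C (depending only on α and β) such that for every X ∈ ℝ: ∫_0^1 (1+|X−τ|)^{−β} τ^{1−α} (−log τ) dτ ≤ C·(1+|X|)^{−β}. -/
open MeasureTheory Real

/-- Real powers of two positive numbers comparable up to a factor `c` are comparable. -/
lemma rpow_le_const_rpow_abs_mul_rpow {a b c : ℝ} (ha : 0 < a) (hb : 0 < b) (hc : 0 < c)
    (hab : a ≤ c * b) (hba : b ≤ c * a) (p : ℝ) : a ^ p ≤ c ^ |p| * b ^ p := by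
  rcases le_total 0 p with hp | hp
  · rw [abs_of_nonneg hp, ← mul_rpow hc.le hb.le]
    exact rpow_le_rpow ha.le hab hp
  · have h := rpow_le_rpow_of_nonpos hb hba hp
    rw [mul_rpow hc.le ha.le] at h
    rw [abs_of_nonpos hp]
    calc a ^ p = c ^ (-p) * (c ^ p * a ^ p) := by
          rw [← mul_assoc, ← rpow_add hc, neg_add_cancel, rpow_zero, one_mul]
      _ ≤ c ^ (-p) * b ^ p := by gcongr

lemma neg_log_le_rpow_neg_div {x ε : ℝ} (hx : 0 < x) (hε : 0 < ε) :
    -log x ≤ x ^ (-ε) / ε := by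
  have h := log_le_rpow_div (inv_nonneg.2 hx.le) hε
  rwa [log_inv, inv_rpow hx.le, ← rpow_neg hx.le] at h

/-- Lemma (crucial integral estimate, part 2): if `α < 2`, then for any `β`,
`∫_0^1 (1+|X−τ|)^{−β} τ^{1−α} (−log τ) dτ ≤ C (1+|X|)^{−β}`. -/
theorem integral_estimate_two
    (α β : ℝ) (hα : α < 2) :
    ∃ C : ℝ, ∀ X : ℝ,
      (∫ τ in Set.Ioo (0 : ℝ) 1, (1 + |X - τ|) ^ (-β) * τ ^ (1 - α) * (-Real.log τ))
        ≤ C * (1 + |X|) ^ (-β) := by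
  have hε : 0 < (2 - α) / 2 := by linarith
  have hint : IntegrableOn (fun τ : ℝ => τ ^ (-α / 2)) (Set.Ioo 0 1) :=
    (intervalIntegral.integrableOn_Ioo_rpow_iff one_pos).2 (by linarith)
  refine ⟨2 ^ |-β| / ((2 - α) / 2) * ∫ τ in Set.Ioo (0 : ℝ) 1, τ ^ (-α / 2), fun X => ?_⟩
  rw [mul_right_comm, ← integral_const_mul]
  refine integral_mono_of_nonneg ?_ (hint.const_mul _) ?_
  · filter_upwards [ae_restrict_mem measurableSet_Ioo] with τ hτ
    have hlog : 0 ≤ -log τ := neg_nonneg.2 (log_nonpos hτ.1.le hτ.2.le)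
    have := hτ.1
    simp only [Pi.zero_apply]
    positivity
  · filter_upwards [ae_restrict_mem measurableSet_Ioo] with τ hτ
    have hτ0 := hτ.1
    have hlog := neg_log_le_rpow_neg_div hτ0 hε
    have hlog0 : 0 ≤ -log τ := neg_nonneg.2 (log_nonpos hτ.1.le hτ.2.le)
    have habs : |τ| < 1 := by rw [abs_of_pos hτ0]; exact hτ.2
    have hweight : (1 + |X - τ|) ^ (-β) ≤ 2 ^ |-β| * (1 + |X|) ^ (-β) := by
      apply rpow_le_const_rpow_abs_mul_rpow (by positivity) (by positivity) two_pos
      · linarith [abs_sub X τ, abs_nonneg X]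
      · linarith [abs_sub_abs_le_abs_sub X τ, abs_nonneg (X - τ)]
    calc (1 + |X - τ|) ^ (-β) * τ ^ (1 - α) * (-log τ)
        ≤ (2 ^ |-β| * (1 + |X|) ^ (-β)) * τ ^ (1 - α) *
            (τ ^ (-((2 - α) / 2)) / ((2 - α) / 2)) := by gcongr
      _ = 2 ^ |-β| / ((2 - α) / 2) * (1 + |X|) ^ (-β) *
            (τ ^ (1 - α) * τ ^ (-((2 - α) / 2))) := by ring
      _ = 2 ^ |-β| / ((2 - α) / 2) * (1 + |X|) ^ (-β) * τ ^ (-α / 2) := by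
          rw [← rpow_add hτ0]
          ring_nf
end

section
/- Let α < 2 and 0 ≤ β < 1 with 2−α ≥ β. Then there exists a constant C (depending only on α and β) such that for every X ∈ ℝ and every T ≥ 2: ∫_0^T (1+|X−τ|)^{−β} τ^{1−α} dτ ≤ C·T^{2−α−β}·L(T), where L(T) = log T if 2−α = β and L(T) = 1 if 2−α ≠ β. -/
open MeasureTheory Real

lemma continuous_one_add_abs_rpow (p : ℝ) : Continuous fun u : ℝ => (1 + |u|) ^ p :=
  (continuous_const.add continuous_abs).rpow_const fun u => Or.inl
    (show 1 + |u| ≠ 0 by positivity)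

/-- Among all windows of length `T`, the integral of `(1 + |u|) ^ p` with `p ≤ 0` is, up to a
factor `3`, largest on the window starting at the peak. -/
lemma setIntegral_one_add_abs_sub_rpow_le {p T : ℝ} (hp : p ≤ 0) (hT : 0 ≤ T) (X : ℝ) :
    ∫ τ in Set.Ioo 0 T, (1 + |X - τ|) ^ p ≤ 3 * ∫ u in (0 : ℝ)..T, (1 + |u|) ^ p := by
  set g : ℝ → ℝ := fun u => (1 + |u|) ^ p with hg
  have hgc : Continuous g := continuous_one_add_abs_rpow p
  have hg0 : ∀ u, 0 ≤ g u := fun u => by positivity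
  have hanti : ∀ {u v : ℝ}, |u| ≤ |v| → g v ≤ g u := fun {u v} huv =>
    rpow_le_rpow_of_nonpos (by positivity) (by linarith) hp
  have hind : Integrable ((Set.Ioc (-T) T).indicator g) := by
    rw [integrable_indicator_iff measurableSet_Ioc]
    exact hgc.integrableOn_Ioc
  have hend : T * g T ≤ ∫ u in (0 : ℝ)..T, g u := by
    have hmono := intervalIntegral.integral_mono_on (μ := volume) (f := fun _ => g T) (g := g) hT
      (by simp) (hgc.intervalIntegrable _ _) (fun u hu => hanti (by
        rw [abs_of_nonneg hu.1, abs_of_nonneg hT]; exact hu.2))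
    simpa using hmono
  have hsymm : ∫ u in (-T)..T, g u = 2 * ∫ u in (0 : ℝ)..T, g u := by
    rw [← intervalIntegral.integral_add_adjacent_intervals
      (hgc.intervalIntegrable (-T) 0) (hgc.intervalIntegrable 0 T)]
    have hneg := intervalIntegral.integral_comp_neg (a := 0) (b := T) g
    have heven : (fun u => g (-u)) = g := by ext u; simp [hg]
    simp only [heven, neg_zero] at hneg
    rw [← hneg]; ring
  have hsplit : ∀ u, g u ≤ g T + (Set.Ioc (-T) T).indicator g u := by
    intro u
    by_cases hu : u ∈ Set.Ioc (-T) T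
    · rw [Set.indicator_of_mem hu]; linarith [hg0 T]
    · rw [Set.indicator_of_notMem hu, add_zero]
      refine hanti ?_
      rw [abs_of_nonneg hT]
      by_contra! hlt
      exact hu ⟨(abs_lt.1 hlt).1, (abs_lt.1 hlt).2.le⟩
  calc ∫ τ in Set.Ioo 0 T, (1 + |X - τ|) ^ p
      = ∫ u in (X - T)..X, g u := by
        rw [← integral_Ioc_eq_integral_Ioo, ← intervalIntegral.integral_of_le hT]
        exact (intervalIntegral.integral_comp_sub_left g X).trans (by rw [sub_zero])
    _ ≤ ∫ u in (X - T)..X, (g T + (Set.Ioc (-T) T).indicator g u) :=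
        intervalIntegral.integral_mono_on (by linarith) (hgc.intervalIntegrable _ _)
          (intervalIntegrable_const.add hind.intervalIntegrable) fun u _ => hsplit u
    _ = T * g T + ∫ u in (X - T)..X, (Set.Ioc (-T) T).indicator g u := by
        rw [intervalIntegral.integral_add intervalIntegrable_const hind.intervalIntegrable]
        simp
    _ ≤ T * g T + ∫ u in (-T)..T, g u := by
        gcongr
        rw [intervalIntegral.integral_of_le (by linarith),
          intervalIntegral.integral_of_le (by linarith),
          ← integral_indicator (f := g) measurableSet_Ioc]
        exact setIntegral_le_integral hind
          (Filter.Eventually.of_forall fun u => Set.indicator_nonneg (fun v _ => hg0 v) u)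
    _ ≤ 3 * ∫ u in (0 : ℝ)..T, g u := by rw [hsymm]; linarith

lemma integral_one_add_abs_rpow_eq {p T : ℝ} (hT : 0 ≤ T) :
    ∫ u in (0 : ℝ)..T, (1 + |u|) ^ p = ∫ x in (1 : ℝ)..(1 + T), x ^ p := by
  have hshift := intervalIntegral.integral_comp_add_left (a := 0) (b := T) (fun x : ℝ => x ^ p) 1
  rw [add_zero] at hshift
  rw [← hshift]
  refine intervalIntegral.integral_congr fun u hu => ?_
  rw [Set.uIcc_of_le hT] at hu
  simp only [abs_of_nonneg hu.1]

lemma half_le_log {T : ℝ} (hT : 2 ≤ T) : 1 / 2 ≤ log T := by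
  have := log_le_log (by norm_num) hT
  linarith [log_two_gt_d9]

lemma integral_one_add_abs_rpow_le {p : ℝ} (hp : -1 ≤ p) :
    ∃ C : ℝ, ∀ T : ℝ, 2 ≤ T → ∫ u in (0 : ℝ)..T, (1 + |u|) ^ p
      ≤ C * (T ^ (p + 1) * if p + 1 = 0 then log T else 1) := by
  rcases hp.eq_or_lt with rfl | hp
  · refine ⟨2, fun T hT => ?_⟩
    rw [integral_one_add_abs_rpow_eq (by linarith)]
    simp only [rpow_neg_one]
    rw [integral_inv_of_pos one_pos (by linarith)]
    simp only [div_one, neg_add_cancel, rpow_zero, if_true, one_mul]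
    calc log (1 + T) ≤ log (T ^ 2) := log_le_log (by linarith) (by nlinarith)
      _ = 2 * log T := by simp
  · have hq : 0 < p + 1 := by linarith
    refine ⟨2 ^ (p + 1) / (p + 1), fun T hT => ?_⟩
    rw [integral_one_add_abs_rpow_eq (by linarith), integral_rpow (Or.inl hp), if_neg hq.ne',
      one_rpow, mul_one, div_mul_eq_mul_div, ← mul_rpow (by norm_num) (by linarith)]
    gcongr
    have : (1 + T) ^ (p + 1) ≤ (2 * T) ^ (p + 1) :=
      rpow_le_rpow (by linarith) (by linarith) hq.le
    linarith

lemma rpow_mul_rpow_le_add {a b s t : ℝ} (ha : 0 < a) (hb : 0 < b) (hs : s ≤ 0) (ht : t ≤ 0) :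
    a ^ s * b ^ t ≤ a ^ (s + t) + b ^ (s + t) := by
  rw [rpow_add ha, rpow_add hb]
  rcases le_total a b with hab | hab
  · have := mul_le_mul_of_nonneg_left (rpow_le_rpow_of_nonpos ha hab ht) (rpow_nonneg ha.le s)
    have : 0 ≤ b ^ s * b ^ t := by positivity
    linarith
  · have := mul_le_mul_of_nonneg_right (rpow_le_rpow_of_nonpos hb hab hs) (rpow_nonneg hb.le t)
    have : 0 ≤ a ^ s * a ^ t := by positivity
    linarith

lemma rpow_le_two_mul_one_add_rpow {τ t : ℝ} (hτ : 1 ≤ τ) (ht : -1 ≤ t) (ht0 : t ≤ 0) :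
    τ ^ t ≤ 2 * (1 + τ) ^ t := by
  have hhalf : τ ^ t ≤ ((1 + τ) / 2) ^ t :=
    rpow_le_rpow_of_nonpos (by linarith) (by linarith) ht0
  have htwo : (2 : ℝ)⁻¹ ≤ 2 ^ t := by
    rw [← rpow_neg_one]
    exact rpow_le_rpow_of_exponent_le (by norm_num) ht
  rw [div_rpow (by linarith) (by norm_num)] at hhalf
  refine hhalf.trans ?_
  rw [div_le_iff₀ (by positivity)]
  nlinarith [rpow_nonneg (show 0 ≤ 1 + τ by linarith) t]

lemma integrableOn_one_add_abs_sub_rpow (p X T : ℝ) :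
    IntegrableOn (fun τ : ℝ => (1 + |X - τ|) ^ p) (Set.Ioo 0 T) :=
  (((continuous_one_add_abs_rpow p).comp
    (continuous_const.sub continuous_id)).integrableOn_Icc (a := 0) (b := T)).mono_set
      Set.Ioo_subset_Icc_self

lemma setIntegral_le_of_one_le {β γ T : ℝ} (hβ : 0 ≤ β) (hγ : 1 ≤ γ) (hT : 0 ≤ T) (X : ℝ) :
    ∫ τ in Set.Ioo 0 T, (1 + |X - τ|) ^ (-β) * τ ^ (γ - 1)
      ≤ T ^ (γ - 1) * (3 * ∫ u in (0 : ℝ)..T, (1 + |u|) ^ (-β)) := by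
  refine le_trans ?_ (mul_le_mul_of_nonneg_left
    (setIntegral_one_add_abs_sub_rpow_le (neg_nonpos.2 hβ) hT X) (by positivity))
  rw [← integral_const_mul]
  refine integral_mono_of_nonneg ?_ ((integrableOn_one_add_abs_sub_rpow _ X T).const_mul _) ?_
  · filter_upwards [ae_restrict_mem measurableSet_Ioo] with τ hτ
    have := hτ.1
    simp only [Pi.zero_apply]
    positivity
  · filter_upwards [ae_restrict_mem measurableSet_Ioo] with τ hτ
    rw [mul_comm]
    exact mul_le_mul_of_nonneg_right (rpow_le_rpow hτ.1.le hτ.2.le (by linarith)) (by positivity)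

lemma setIntegral_le_of_le_one {β γ T : ℝ} (hβ : 0 ≤ β) (hγ0 : 0 < γ) (hγ : γ ≤ 1) (hT : 0 ≤ T)
    (X : ℝ) :
    ∫ τ in Set.Ioo 0 T, (1 + |X - τ|) ^ (-β) * τ ^ (γ - 1)
      ≤ 1 / γ + 12 * ∫ u in (0 : ℝ)..T, (1 + |u|) ^ (γ - β - 1) := by
  set p := γ - β - 1 with hp
  have hp0 : p ≤ 0 := by linarith
  have hpow : IntegrableOn (fun τ : ℝ => τ ^ (γ - 1)) (Set.Ioc 0 1) :=
    (intervalIntegrable_iff_integrableOn_Ioc_of_le zero_le_one).1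
      (intervalIntegral.intervalIntegrable_rpow' (by linarith))
  have hind : Integrable ((Set.Ioc (0 : ℝ) 1).indicator fun τ : ℝ => τ ^ (γ - 1)) :=
    (integrable_indicator_iff measurableSet_Ioc).2 hpow
  have hX := integrableOn_one_add_abs_sub_rpow p X T
  have h0 := integrableOn_one_add_abs_sub_rpow p 0 T
  have hsum : IntegrableOn (fun τ : ℝ => 2 * ((1 + |X - τ|) ^ p + (1 + |0 - τ|) ^ p))
      (Set.Ioo 0 T) := (hX.add h0).const_mul 2
  have hnear : ∫ τ in Set.Ioo 0 T, (Set.Ioc (0 : ℝ) 1).indicator (fun τ : ℝ => τ ^ (γ - 1)) τ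
      ≤ 1 / γ := by
    refine (setIntegral_le_integral hind (Filter.Eventually.of_forall fun u =>
      Set.indicator_nonneg (fun v hv => rpow_nonneg hv.1.le _) u)).trans ?_
    rw [integral_indicator measurableSet_Ioc, ← intervalIntegral.integral_of_le zero_le_one,
      integral_rpow (Or.inl (by linarith)), sub_add_cancel, one_rpow, zero_rpow hγ0.ne', sub_zero]
  have hmono : ∫ τ in Set.Ioo 0 T, (1 + |X - τ|) ^ (-β) * τ ^ (γ - 1)
      ≤ ∫ τ in Set.Ioo 0 T, ((Set.Ioc (0 : ℝ) 1).indicator (fun τ : ℝ => τ ^ (γ - 1)) τ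
        + 2 * ((1 + |X - τ|) ^ p + (1 + |0 - τ|) ^ p)) := by
    refine integral_mono_of_nonneg ?_ (hind.integrableOn.add hsum) ?_
    · filter_upwards [ae_restrict_mem measurableSet_Ioo] with τ hτ
      have := hτ.1
      simp only [Pi.zero_apply]
      positivity
    · filter_upwards [ae_restrict_mem measurableSet_Ioo] with τ hτ
      have hτ0 := hτ.1
      by_cases hτ1 : τ ≤ 1
      · rw [Set.indicator_of_mem (show τ ∈ Set.Ioc (0 : ℝ) 1 from ⟨hτ0, hτ1⟩)]
        have hle : (1 + |X - τ|) ^ (-β) ≤ 1 :=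
          rpow_le_one_of_one_le_of_nonpos (by linarith [abs_nonneg (X - τ)]) (by linarith)
        have := mul_le_mul_of_nonneg_right hle (rpow_nonneg hτ0.le (γ - 1))
        have : 0 ≤ 2 * ((1 + |X - τ|) ^ p + (1 + |0 - τ|) ^ p) := by positivity
        linarith
      · rw [Set.indicator_of_notMem fun hmem => hτ1 hmem.2, zero_add, zero_sub, abs_neg,
          abs_of_pos hτ0]
        have hle := mul_le_mul_of_nonneg_left
          (rpow_le_two_mul_one_add_rpow (t := γ - 1) (not_le.1 hτ1).le (by linarith) (by linarith))
          (rpow_nonneg (show 0 ≤ 1 + |X - τ| by positivity) (-β))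
        have hadd := rpow_mul_rpow_le_add (a := 1 + |X - τ|) (b := 1 + τ) (s := -β) (t := γ - 1)
          (by positivity) (by positivity) (by linarith) (by linarith)
        rw [show -β + (γ - 1) = p by rw [hp]; ring] at hadd
        linarith
  rw [integral_add hind.integrableOn hsum, integral_const_mul,
    integral_add hX h0] at hmono
  linarith [setIntegral_one_add_abs_sub_rpow_le hp0 hT X,
    setIntegral_one_add_abs_sub_rpow_le hp0 hT 0]

/-- Lemma (crucial integral estimate, part 3): if `0 ≤ β < 1` and `2−α ≥ β`, then
`∫_0^T (1+|X−τ|)^{−β} τ^{1−α} dτ ≤ C T^{2−α−β} log^{δ_{2−α,β}}(T)` for `T ≥ 2`. -/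
theorem integral_estimate_three
    (α β : ℝ) (hα : α < 2) (hβ0 : 0 ≤ β) (hβ1 : β < 1) (h : β ≤ 2 - α) :
    ∃ C : ℝ, ∀ X : ℝ, ∀ T : ℝ, 2 ≤ T →
      (∫ τ in Set.Ioo (0 : ℝ) T, (1 + |X - τ|) ^ (-β) * τ ^ (1 - α))
        ≤ C * T ^ (2 - α - β) * (if 2 - α = β then Real.log T else 1) := by
  obtain ⟨γ, rfl⟩ : ∃ γ, α = 2 - γ := ⟨2 - α, by ring⟩
  simp only [sub_sub_cancel, show 1 - (2 - γ) = γ - 1 by ring] at h ⊢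
  have hγ0 : 0 < γ := by linarith
  rcases le_total 1 γ with hγ | hγ
  · obtain ⟨C, hC⟩ := integral_one_add_abs_rpow_le (p := -β) (by linarith)
    refine ⟨3 * C, fun X T hT => (setIntegral_le_of_one_le hβ0 hγ (by linarith) X).trans ?_⟩
    have hJ := hC T hT
    rw [if_neg (by linarith), mul_one] at hJ
    rw [if_neg (by linarith), mul_one, show γ - β = (γ - 1) + (-β + 1) by ring,
      rpow_add (by linarith : (0 : ℝ) < T)]
    have := mul_le_mul_of_nonneg_left hJ (rpow_nonneg (by linarith : (0 : ℝ) ≤ T) (γ - 1))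
    linarith
  · obtain ⟨C, hC⟩ := integral_one_add_abs_rpow_le (p := γ - β - 1) (by linarith)
    refine ⟨2 / γ + 12 * C, fun X T hT =>
      (setIntegral_le_of_le_one hβ0 hγ0 hγ (by linarith) X).trans ?_⟩
    have hJ := hC T hT
    simp only [sub_add_cancel, sub_eq_zero] at hJ
    rw [mul_assoc]
    set M := T ^ (γ - β) * if γ = β then log T else 1 with hM
    have hhalf : 1 / 2 ≤ M := by
      have hone : 1 ≤ T ^ (γ - β) := one_le_rpow (by linarith) (by linarith)
      have hlog : 1 / 2 ≤ if γ = β then log T else 1 := by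
        split_ifs
        · exact half_le_log hT
        · norm_num
      nlinarith
    have : 2 / γ * (1 / 2) ≤ 2 / γ * M := mul_le_mul_of_nonneg_left hhalf (by positivity)
    have : 2 / γ * (1 / 2) = 1 / γ := by ring
    linarith
end

section
/- Let 0 ≤ β < 1 and α > 1. Then there exists a constant C (depending only on α and β) such that for every X ∈ ℝ and every T ≥ 2: ∫_T^{+∞} (1+|X−τ|)^{−β} τ^{1−2α} dτ ≤ C·T^{2−2α−β}. -/
open MeasureTheory Real

lemma integral_truncated_rpow_abs_sub {β : ℝ} (hβ1 : β < 1) (X : ℝ) {T : ℝ} (hT : 0 ≤ T) :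
    ∫ τ : ℝ, (Set.Ioc 0 T).indicator (fun s => s ^ (-β)) |X - τ|
      = 2 * (T ^ (1 - β) / (1 - β)) := by
  rw [integral_sub_left_eq_self (fun x => (Set.Ioc 0 T).indicator (fun s : ℝ => s ^ (-β)) |x|),
    integral_comp_abs, setIntegral_indicator measurableSet_Ioc,
    Set.inter_eq_right.2 Set.Ioc_subset_Ioi_self, ← intervalIntegral.integral_of_le hT,
    integral_rpow (Or.inl (by linarith)), neg_add_eq_sub, zero_rpow (by linarith), sub_zero]

/-- The truncated power `s ↦ s ^ (-β)` on `(0, T]`, evaluated at `|X - τ|`, is integrable in `τ`,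
because its Bochner integral is nonzero. -/
lemma integrable_truncated_rpow_abs_sub {β : ℝ} (hβ1 : β < 1) (X : ℝ) {T : ℝ} (hT : 0 < T) :
    Integrable (fun τ : ℝ => (Set.Ioc 0 T).indicator (fun s => s ^ (-β)) |X - τ|) := by
  refine .of_integral_ne_zero ?_
  rw [integral_truncated_rpow_abs_sub hβ1 X hT.le]
  have : 0 < 1 - β := sub_pos.2 hβ1
  positivity

/-- Lemma (crucial integral estimate, part 4): if `0 ≤ β < 1` and `α > 1`, then
`∫_T^∞ (1+|X−τ|)^{−β} τ^{1−2α} dτ ≤ C T^{2−2α−β}` for `T ≥ 2`. -/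
theorem integral_estimate_four
    (α β : ℝ) (hβ0 : 0 ≤ β) (hβ1 : β < 1) (hα : 1 < α) :
    ∃ C : ℝ, ∀ X : ℝ, ∀ T : ℝ, 2 ≤ T →
      (∫ τ in Set.Ioi T, (1 + |X - τ|) ^ (-β) * τ ^ (1 - 2 * α))
        ≤ C * T ^ (2 - 2 * α - β) := by
  refine ⟨1 / (2 * α - 2) + 2 / (1 - β), fun X T hT => ?_⟩
  have hT0 : 0 < T := by linarith
  set G : ℝ → ℝ := fun τ => (Set.Ioc 0 T).indicator (fun s => s ^ (-β)) |X - τ|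
  have hG0 : ∀ τ, 0 ≤ G τ := fun τ =>
    Set.indicator_nonneg (fun s hs => rpow_nonneg hs.1.le _) _
  have hGi : Integrable G := integrable_truncated_rpow_abs_sub hβ1 X hT0
  have hPi : IntegrableOn (fun τ : ℝ => τ ^ (1 - 2 * α)) (Set.Ioi T) :=
    integrableOn_Ioi_rpow_of_lt (by linarith) hT0
  have hpt : ∀ᵐ τ ∂(volume.restrict (Set.Ioi T)),
      (1 + |X - τ|) ^ (-β) * τ ^ (1 - 2 * α)
        ≤ T ^ (-β) * τ ^ (1 - 2 * α) + T ^ (1 - 2 * α) * G τ := by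
    filter_upwards [ae_restrict_mem measurableSet_Ioi,
      ae_restrict_of_ae (Measure.ae_ne volume X)] with τ hτ hne
    have hτT : T < τ := hτ
    have hpos : 0 < |X - τ| := abs_pos.2 (sub_ne_zero.2 hne.symm)
    have hτ0 : 0 ≤ τ ^ (1 - 2 * α) := rpow_nonneg (by linarith) _
    rcases le_or_gt |X - τ| T with h | h
    · have hGτ : G τ = |X - τ| ^ (-β) := Set.indicator_of_mem (Set.mem_Ioc.2 ⟨hpos, h⟩) _
      have h1 : (1 + |X - τ|) ^ (-β) ≤ G τ :=
        hGτ ▸ rpow_le_rpow_of_nonpos hpos (by linarith) (by linarith)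
      have h2 : τ ^ (1 - 2 * α) ≤ T ^ (1 - 2 * α) :=
        rpow_le_rpow_of_nonpos hT0 hτT.le (by linarith)
      have h3 := mul_le_mul h1 h2 hτ0 (hG0 τ)
      have h4 : 0 ≤ T ^ (-β) * τ ^ (1 - 2 * α) := mul_nonneg (rpow_nonneg hT0.le _) hτ0
      linarith
    · have h1 : (1 + |X - τ|) ^ (-β) ≤ T ^ (-β) :=
        rpow_le_rpow_of_nonpos hT0 (by linarith) (by linarith)
      have h2 := mul_le_mul_of_nonneg_right h1 hτ0
      have h3 : 0 ≤ T ^ (1 - 2 * α) * G τ := mul_nonneg (rpow_nonneg hT0.le _) (hG0 τ)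
      linarith
  have hnonneg : ∀ᵐ τ ∂(volume.restrict (Set.Ioi T)),
      0 ≤ (1 + |X - τ|) ^ (-β) * τ ^ (1 - 2 * α) := by
    filter_upwards [ae_restrict_mem measurableSet_Ioi] with τ hτ
    have : 0 < τ := hT0.trans hτ
    positivity
  have hGle : ∫ τ in Set.Ioi T, G τ ≤ 2 * (T ^ (1 - β) / (1 - β)) :=
    (setIntegral_le_integral hGi (Filter.Eventually.of_forall hG0)).trans_eq
      (integral_truncated_rpow_abs_sub hβ1 X hT0.le)
  calc ∫ τ in Set.Ioi T, (1 + |X - τ|) ^ (-β) * τ ^ (1 - 2 * α)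
      ≤ ∫ τ in Set.Ioi T, (T ^ (-β) * τ ^ (1 - 2 * α) + T ^ (1 - 2 * α) * G τ) :=
        integral_mono_of_nonneg hnonneg
          ((hPi.const_mul _).add (hGi.integrableOn.const_mul _)) hpt
    _ = T ^ (-β) * (∫ τ in Set.Ioi T, τ ^ (1 - 2 * α))
          + T ^ (1 - 2 * α) * ∫ τ in Set.Ioi T, G τ := by
        rw [integral_add (hPi.const_mul _) (hGi.integrableOn.const_mul _),
          integral_const_mul, integral_const_mul]
    _ ≤ T ^ (-β) * (T ^ (2 - 2 * α) / (2 * α - 2))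
          + T ^ (1 - 2 * α) * (2 * (T ^ (1 - β) / (1 - β))) := by
        rw [integral_Ioi_rpow_of_lt (by linarith) hT0,
          show 1 - 2 * α + 1 = -(2 * α - 2) by ring, neg_div_neg_eq,
          show -(2 * α - 2) = 2 - 2 * α by ring]
        gcongr
    _ = (1 / (2 * α - 2) + 2 / (1 - β)) * T ^ (2 - 2 * α - β) := by
        have h1 : T ^ (2 - 2 * α - β) = T ^ (-β) * T ^ (2 - 2 * α) := by
          rw [← rpow_add hT0]; ring_nf
        have h2 : T ^ (2 - 2 * α - β) = T ^ (1 - 2 * α) * T ^ (1 - β) := by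
          rw [← rpow_add hT0]; ring_nf
        rw [add_mul]
        nth_rewrite 1 [h1]
        rw [h2]
        ring
end

section
/- Let 3/2 ≤ α < 2 and β > 2−α. Then there exists a constant C (depending only on α and β) such that for every k ∈ ℝ² with |k| ≥ 2 and every Y ∈ ℝ: ∫_{ℝ²} |x|^{−α} |k−x|^{−α} (1+|Y−|x|−|k−x||)^{−β} dx ≤ C·|k|^{−α}·L₁(|k|)·(1+|Y−|k||)^{2−α−min{1,β}}·L₂(Y,k), where L₁(|k|) = log|k| if α = 3/2 and L₁(|k|) = 1 if α ≠ 3/2, and L₂(Y,k) = log(2+|Y−|k||) if β = 1 and L₂(Y,k) = 1 if β ≠ 1. -/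
open MeasureTheory Real

/-- A change of variables inequality which does not require injectivity. -/
lemma lintegral_le_lintegral_of_surjOn_of_hasDerivAt {f f' : ℂ → ℂ} {s : Set ℂ}
    (hs : MeasurableSet s) (hf : ∀ z, HasDerivAt f (f' z) z) (hf' : Measurable f')
    (hsurj : Set.SurjOn f s Set.univ) {g : ℂ → ENNReal} (hg : Measurable g) :
    ∫⁻ x, g x ≤ ∫⁻ z in s, ENNReal.ofReal (‖f' z‖ ^ 2) * g (f z) := by
  have hfm : Measurable f :=
    (continuous_iff_continuousAt.2 fun z => (hf z).continuousAt).measurable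
  have hdens : Measurable fun z => ENNReal.ofReal (‖f' z‖ ^ 2) := by fun_prop
  have key : (volume : Measure ℂ) ≤
      ((volume.restrict s).withDensity fun z => ENNReal.ofReal (‖f' z‖ ^ 2)).map f := by
    refine Measure.le_iff.2 fun B hB => ?_
    rw [Measure.map_apply hfm hB, withDensity_apply _ (hfm hB),
      Measure.restrict_restrict (hfm hB)]
    have himg : f '' (f ⁻¹' B ∩ s) = B := by
      ext x
      constructor
      · rintro ⟨z, hz, rfl⟩
        exact hz.1
      · intro hx
        obtain ⟨z, hz, rfl⟩ := hsurj (Set.mem_univ x)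
        exact ⟨z, ⟨hx, hz⟩, rfl⟩
    have h := addHaar_image_le_lintegral_abs_det_fderiv (volume : Measure ℂ)
      (s := f ⁻¹' B ∩ s) (f := f)
      (f' := fun z => (ContinuousLinearMap.toSpanSingleton ℂ (f' z)).restrictScalars ℝ)
      ((hfm hB).inter hs) (fun z _ => ((hf z).hasFDerivAt.restrictScalars ℝ).hasFDerivWithinAt)
    rw [himg] at h
    refine h.trans (le_of_eq (lintegral_congr fun z => ?_))
    congr 1
    have : ((ContinuousLinearMap.toSpanSingleton ℂ (f' z)).restrictScalars ℝ).det
        = ‖f' z‖ ^ 2 := by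
      rw [ContinuousLinearMap.det, ← LinearMap.det_toMatrix Complex.basisOneI,
        Matrix.det_fin_two, ← Complex.normSq_eq_norm_sq, Complex.normSq_apply]
      simp [LinearMap.toMatrix_apply]
    rw [this, abs_of_nonneg (by positivity)]
  calc ∫⁻ x, g x ≤ ∫⁻ x, g x ∂(((volume.restrict s).withDensity
        fun z => ENNReal.ofReal (‖f' z‖ ^ 2)).map f) := lintegral_mono' key le_rfl
    _ = _ := by
      rw [lintegral_map hg hfm]
      exact lintegral_withDensity_eq_lintegral_mul _ hdens (hg.comp hfm)

lemma Complex.exists_cosh_eq (c : ℂ) : ∃ z : ℂ, 0 ≤ z.re ∧ z.im ∈ Set.Icc (-π) π ∧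
    Complex.cosh z = c := by
  obtain ⟨y, rfl⟩ := Complex.cos_surjective c
  have main : ∀ v : ℂ, 0 ≤ v.re →
      ∃ z : ℂ, 0 ≤ z.re ∧ z.im ∈ Set.Icc (-π) π ∧ Complex.cosh z = Complex.cosh v := by
    intro v hv
    let n : ℤ := toIocDiv two_pi_pos (-π) v.im
    have hn : v.im - n • (2 * π) ∈ Set.Ioc (-π) (-π + 2 * π) :=
      sub_toIocDiv_zsmul_mem_Ioc two_pi_pos (-π) v.im
    refine ⟨v - (n * (2 * π) : ℝ) * Complex.I, by simpa using hv, ?_, ?_⟩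
    · simp at hn ⊢
      constructor <;> linarith [hn.1, hn.2]
    · rw [← Complex.cos_mul_I, ← Complex.cos_mul_I, Complex.cos_eq_cos_iff]
      refine ⟨-n, Or.inl ?_⟩
      push_cast
      linear_combination (2 * π * n : ℂ) * Complex.I_mul_I
  have hy : Complex.cosh (y * Complex.I) = Complex.cos y := Complex.cosh_mul_I y
  rcases le_total 0 (y * Complex.I).re with h | h
  · obtain ⟨z, h1, h2, h3⟩ := main _ h
    exact ⟨z, h1, h2, h3.trans hy⟩
  · obtain ⟨z, h1, h2, h3⟩ := main (-(y * Complex.I)) (by simpa using h)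
    exact ⟨z, h1, h2, h3.trans ((Complex.cosh_neg _).trans hy)⟩

lemma Complex.cosh_re_im (z : ℂ) : Complex.cosh z =
    ⟨Real.cosh z.re * Real.cos z.im, Real.sinh z.re * Real.sin z.im⟩ := by
  conv_lhs => rw [← Complex.re_add_im z, Complex.cosh_add, Complex.cosh_mul_I, Complex.sinh_mul_I]
  rw [← Complex.ofReal_cosh, ← Complex.ofReal_sinh, ← Complex.ofReal_cos, ← Complex.ofReal_sin]
  apply Complex.ext <;> simp [-Complex.ofReal_cosh, -Complex.ofReal_sinh, -Complex.ofReal_cos,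
    -Complex.ofReal_sin]

lemma Complex.sinh_re_im (z : ℂ) : Complex.sinh z =
    ⟨Real.sinh z.re * Real.cos z.im, Real.cosh z.re * Real.sin z.im⟩ := by
  conv_lhs => rw [← Complex.re_add_im z, Complex.sinh_add, Complex.cosh_mul_I, Complex.sinh_mul_I]
  rw [← Complex.ofReal_cosh, ← Complex.ofReal_sinh, ← Complex.ofReal_cos, ← Complex.ofReal_sin]
  apply Complex.ext <;> simp [-Complex.ofReal_cosh, -Complex.ofReal_sinh, -Complex.ofReal_cos,
    -Complex.ofReal_sin]

lemma Complex.norm_one_add_cosh (z : ℂ) :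
    ‖1 + Complex.cosh z‖ = Real.cosh z.re + Real.cos z.im := by
  have h0 : 0 ≤ Real.cosh z.re + Real.cos z.im := by
    linarith [Real.one_le_cosh z.re, Real.neg_one_le_cos z.im]
  rw [← sq_eq_sq₀ (norm_nonneg _) h0, ← Complex.normSq_eq_norm_sq, Complex.normSq_apply,
    Complex.cosh_re_im]
  simp only [Complex.add_re, Complex.one_re, Complex.add_im, Complex.one_im]
  nlinarith [Real.cosh_sq z.re, Real.sin_sq_add_cos_sq z.im]

lemma Complex.norm_one_sub_cosh (z : ℂ) :
    ‖1 - Complex.cosh z‖ = Real.cosh z.re - Real.cos z.im := by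
  have h0 : 0 ≤ Real.cosh z.re - Real.cos z.im := by
    linarith [Real.one_le_cosh z.re, Real.cos_le_one z.im]
  rw [← sq_eq_sq₀ (norm_nonneg _) h0, ← Complex.normSq_eq_norm_sq, Complex.normSq_apply,
    Complex.cosh_re_im]
  simp only [Complex.sub_re, Complex.one_re, Complex.sub_im, Complex.one_im]
  nlinarith [Real.cosh_sq z.re, Real.sin_sq_add_cos_sq z.im]

lemma Complex.norm_sinh_sq (z : ℂ) :
    ‖Complex.sinh z‖ ^ 2 = Real.sinh z.re ^ 2 + Real.sin z.im ^ 2 := by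
  rw [← Complex.normSq_eq_norm_sq, Complex.normSq_apply, Complex.sinh_re_im]
  nlinarith [Real.cosh_sq z.re, Real.sin_sq_add_cos_sq z.im]

/-- Elliptic coordinates with foci `0` and `w`. -/
lemma lintegral_norm_norm_sub_le {w : ℂ} (hw : w ≠ 0) {Q : ℝ → ℝ → ENNReal}
    (hQ : Measurable (Function.uncurry Q)) :
    ∫⁻ x : ℂ, Q ‖x‖ ‖w - x‖ ≤ ∫⁻ a in Set.Ioi (0 : ℝ), ∫⁻ b in Set.Icc (-π) π,
      ENNReal.ofReal ((‖w‖ / 2) ^ 2 * (sinh a ^ 2 + sin b ^ 2)) *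
        Q (‖w‖ / 2 * (cosh a + cos b)) (‖w‖ / 2 * (cosh a - cos b)) := by
  have hQ' : ∀ {X : Type} [MeasurableSpace X] (u v : X → ℝ), Measurable u → Measurable v →
      Measurable fun x => Q (u x) (v x) := fun u v hu hv => hQ.comp (hu.prodMk hv)
  have hsm : MeasurableSet (Set.Ici (0 : ℝ) ×ˢ Set.Icc (-π) π) :=
    measurableSet_Ici.prod measurableSet_Icc
  let e := Complex.measurableEquivRealProd
  have h := lintegral_le_lintegral_of_surjOn_of_hasDerivAt
    (f := fun z => w / 2 * (1 + Complex.cosh z)) (f' := fun z => w / 2 * Complex.sinh z)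
    (s := e ⁻¹' (Set.Ici (0 : ℝ) ×ˢ Set.Icc (-π) π)) (e.measurable hsm)
    (fun z => ((Complex.hasDerivAt_cosh z).const_add 1).const_mul (w / 2))
    (by fun_prop)
    (by
      intro x _
      obtain ⟨z, h1, h2, h3⟩ := Complex.exists_cosh_eq (2 * x / w - 1)
      refine ⟨z, ⟨h1, h2⟩, ?_⟩
      simp only [h3]
      field_simp
      ring)
    (g := fun x => Q ‖x‖ ‖w - x‖) (hQ' _ _ (by fun_prop) (by fun_prop))
  refine h.trans (le_of_eq ?_)
  have hval : ∀ z : ℂ, ENNReal.ofReal (‖w / 2 * Complex.sinh z‖ ^ 2) *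
      Q ‖w / 2 * (1 + Complex.cosh z)‖ ‖w - w / 2 * (1 + Complex.cosh z)‖ =
      (fun p : ℝ × ℝ => ENNReal.ofReal ((‖w‖ / 2) ^ 2 * (sinh p.1 ^ 2 + sin p.2 ^ 2)) *
        Q (‖w‖ / 2 * (cosh p.1 + cos p.2)) (‖w‖ / 2 * (cosh p.1 - cos p.2))) (e z) := by
    intro z
    have : w - w / 2 * (1 + Complex.cosh z) = w / 2 * (1 - Complex.cosh z) := by ring
    rw [this, norm_mul, norm_mul, norm_mul, mul_pow, Complex.norm_sinh_sq,
      Complex.norm_one_add_cosh, Complex.norm_one_sub_cosh]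
    simp [e, Complex.measurableEquivRealProd_apply]
  have he : MeasurePreserving e := Complex.volume_preserving_equiv_real_prod
  have hcomp := he.setLIntegral_comp_preimage_emb e.measurableEmbedding
    (fun p : ℝ × ℝ => ENNReal.ofReal ((‖w‖ / 2) ^ 2 * (sinh p.1 ^ 2 + sin p.2 ^ 2)) *
        Q (‖w‖ / 2 * (cosh p.1 + cos p.2)) (‖w‖ / 2 * (cosh p.1 - cos p.2)))
    (Set.Ici (0 : ℝ) ×ˢ Set.Icc (-π) π)
  refine (lintegral_congr hval).trans (hcomp.trans ?_)
  rw [Measure.volume_eq_prod, ← Measure.prod_restrict, lintegral_prod,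
    restrict_Ioi_eq_restrict_Ici]
  refine (Measurable.mul (by fun_prop) (hQ' _ _ ?_ ?_)).aemeasurable <;> fun_prop

lemma setLIntegral_abs_sub_le {h : ℝ → ENNReal} (hh : Measurable h) {A : Set ℝ}
    (hA : MeasurableSet A) {y R : ℝ} (hAR : ∀ u ∈ A, |u - y| ≤ R) :
    ∫⁻ u in A, h |u - y| ≤ 2 * ∫⁻ t in Set.Ioc 0 R, h t := by
  let g : ℝ → ENNReal := (Set.Icc (-R) R).indicator fun t => h |t|
  have h1 : ∫⁻ u in A, h |u - y| ≤ ∫⁻ t in Set.Icc (-R) R, h |t| := by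
    calc ∫⁻ u in A, h |u - y| ≤ ∫⁻ u in A, g (u - y) := by
          refine setLIntegral_mono' hA fun u hu => ?_
          simp only [g]
          rw [Set.indicator_of_mem (Set.mem_Icc.2 (abs_le.1 (hAR u hu)))]
      _ ≤ ∫⁻ u, g (u - y) := setLIntegral_le_lintegral _ _
      _ = ∫⁻ t, g t := lintegral_sub_right_eq_self g y
      _ = _ := lintegral_indicator measurableSet_Icc _
  have h2 : ∫⁻ t in Set.Ico (-R) 0, h |t| = ∫⁻ t in Set.Ioc 0 R, h t := by
    have := (Measure.measurePreserving_neg (volume : Measure ℝ)).setLIntegral_comp_preimage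
      (s := Set.Ioc 0 R) (f := h) measurableSet_Ioc hh
    rw [← this]
    have hpre : (fun x : ℝ => -x) ⁻¹' Set.Ioc 0 R = Set.Ico (-R) 0 := by
      ext x
      simp only [Set.mem_preimage, Set.mem_Ioc, Set.mem_Ico]
      constructor <;> rintro ⟨a, b⟩ <;> constructor <;> linarith
    change _ = ∫⁻ a in (fun x : ℝ => -x) ⁻¹' Set.Ioc 0 R, h (-a)
    rw [hpre]
    exact setLIntegral_congr_fun measurableSet_Ico fun t ht => by
      simp only [abs_of_neg ht.2]
  have h3 : ∫⁻ t in Set.Icc 0 R, h |t| = ∫⁻ t in Set.Ioc 0 R, h t := by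
    rw [← restrict_Ioc_eq_restrict_Icc]
    exact setLIntegral_congr_fun measurableSet_Ioc fun t ht => by simp only [abs_of_pos ht.1]
  calc ∫⁻ u in A, h |u - y| ≤ ∫⁻ t in Set.Icc (-R) R, h |t| := h1
    _ ≤ ∫⁻ t in Set.Ico (-R) 0 ∪ Set.Icc 0 R, h |t| := by
        refine lintegral_mono_set fun t ht => ?_
        rcases lt_or_ge t 0 with h0 | h0
        · exact Or.inl ⟨ht.1, h0⟩
        · exact Or.inr ⟨h0, ht.2⟩
    _ ≤ _ := lintegral_union_le _ _ _
    _ = _ := by rw [h2, h3, two_mul]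

lemma setLIntegral_Ioc_rpow {r c : ℝ} (hr : -1 < r) (hc : 0 ≤ c) :
    ∫⁻ t in Set.Ioc 0 c, ENNReal.ofReal (t ^ r) = ENNReal.ofReal (c ^ (r + 1) / (r + 1)) := by
  rw [← ofReal_integral_eq_lintegral_ofReal
    ((intervalIntegrable_iff_integrableOn_Ioc_of_le hc).1
      (intervalIntegral.intervalIntegrable_rpow' hr)),
    ← intervalIntegral.integral_of_le hc, integral_rpow (Or.inl hr),
    Real.zero_rpow (by linarith), sub_zero]
  exact (ae_restrict_iff' measurableSet_Ioc).2 (.of_forall fun t ht => rpow_nonneg ht.1.le _)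

lemma setLIntegral_Ioi_rpow {r c : ℝ} (hr : r < -1) (hc : 0 < c) :
    ∫⁻ t in Set.Ioi c, ENNReal.ofReal (t ^ r) = ENNReal.ofReal (-c ^ (r + 1) / (r + 1)) := by
  rw [← ofReal_integral_eq_lintegral_ofReal (integrableOn_Ioi_rpow_of_lt hr hc),
    integral_Ioi_rpow_of_lt hr hc]
  exact (ae_restrict_iff' measurableSet_Ioi).2
    (.of_forall fun t ht => rpow_nonneg (hc.trans ht).le _)

lemma setLIntegral_Ioc_inv {c d : ℝ} (hc : 0 < c) (hcd : c ≤ d) :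
    ∫⁻ t in Set.Ioc c d, ENNReal.ofReal (t ^ (-1 : ℝ)) = ENNReal.ofReal (log (d / c)) := by
  simp_rw [rpow_neg_one]
  rw [← ofReal_integral_eq_lintegral_ofReal
    ((intervalIntegrable_iff_integrableOn_Ioc_of_le hcd).1
      (intervalIntegrable_inv_iff.2 (Or.inr ?_))),
    ← intervalIntegral.integral_of_le hcd, integral_inv_of_pos hc (hc.trans_le hcd)]
  · exact (ae_restrict_iff' measurableSet_Ioc).2
      (.of_forall fun t ht => inv_nonneg.2 (hc.trans ht.1).le)
  · rw [Set.uIcc_of_le hcd]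
    exact fun h => absurd h.1 (not_le.2 hc)

lemma exists_setLIntegral_one_add_rpow_le (β : ℝ) : ∃ C : ℝ, 0 ≤ C ∧ ∀ M : ℝ, 1 ≤ M →
    ∫⁻ t in Set.Ioc 0 (3 * M), ENNReal.ofReal ((1 + t) ^ (-β)) ≤
      ENNReal.ofReal (C * (M ^ (1 - min 1 β) * if β = 1 then log (1 + M) else 1)) := by
  have hshift : ∀ M : ℝ, ∫⁻ t in Set.Ioc 0 (3 * M), ENNReal.ofReal ((1 + t) ^ (-β)) =
      ∫⁻ t in Set.Ioc 1 (1 + 3 * M), ENNReal.ofReal (t ^ (-β)) := by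
    intro M
    have := (measurePreserving_add_left (volume : Measure ℝ) 1).setLIntegral_comp_preimage
      (s := Set.Ioc 1 (1 + 3 * M)) (f := fun t => ENNReal.ofReal (t ^ (-β))) measurableSet_Ioc
      (by fun_prop)
    rw [← this, Set.preimage_const_add_Ioc]
    simp
  simp_rw [hshift]
  rcases lt_trichotomy β 1 with hb | hb | hb
  · refine ⟨4 ^ (1 - β) / (1 - β), div_nonneg (by positivity) (by linarith), fun M hM => ?_⟩
    rw [if_neg hb.ne, min_eq_right hb.le]
    calc _ ≤ ∫⁻ t in Set.Ioc 0 (4 * M), ENNReal.ofReal (t ^ (-β)) :=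
          lintegral_mono_set (Set.Ioc_subset_Ioc (by norm_num) (by linarith))
      _ ≤ _ := by
        rw [setLIntegral_Ioc_rpow (by linarith) (by linarith)]
        apply ENNReal.ofReal_le_ofReal
        rw [mul_rpow (by norm_num) (by linarith), neg_add_eq_sub]
        apply le_of_eq
        ring
  · refine ⟨3, by norm_num, fun M hM => ?_⟩
    rw [if_pos hb, hb, setLIntegral_Ioc_inv one_pos (by linarith)]
    apply ENNReal.ofReal_le_ofReal
    have : log ((1 + 3 * M) / 1) ≤ log ((1 + M) ^ 3) := by
      apply log_le_log (by positivity)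
      nlinarith [mul_nonneg (by linarith : 0 ≤ M) (by linarith : 0 ≤ M),
        pow_nonneg (by linarith : 0 ≤ M) 3]
    rw [log_pow] at this
    simpa using this
  · refine ⟨1 / (β - 1), div_nonneg (by positivity) (by linarith), fun M hM => ?_⟩
    rw [if_neg hb.ne', min_eq_left hb.le]
    calc _ ≤ ∫⁻ t in Set.Ioi 1, ENNReal.ofReal (t ^ (-β)) :=
          lintegral_mono_set Set.Ioc_subset_Ioi_self
      _ ≤ _ := by
        rw [setLIntegral_Ioi_rpow (by linarith) one_pos]
        apply ENNReal.ofReal_le_ofReal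
        simp only [one_rpow, sub_self, rpow_zero, mul_one]
        apply le_of_eq
        rw [neg_div, ← div_neg]
        congr 1
        ring

lemma one_le_two_mul_ite_log (β y : ℝ) : 1 ≤ 2 * if β = 1 then log (2 + |y|) else 1 := by
  split_ifs
  · have : log 2 ≤ log (2 + |y|) := log_le_log (by norm_num) (by linarith [abs_nonneg y])
    linarith [Real.log_two_gt_d9]
  · norm_num

/-- The convolution estimate on the half-line with weight `u ^ (-p)`. -/
lemma exists_setLIntegral_rpow_mul_le {p β : ℝ} (hp0 : 0 ≤ p) (hp : p < 1) (hβ : 1 - p < β) :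
    ∃ C : ℝ, 0 ≤ C ∧ ∀ y : ℝ,
    ∫⁻ u in Set.Ioi 0, ENNReal.ofReal (u ^ (-p) * (1 + |y - u|) ^ (-β)) ≤
      ENNReal.ofReal (C * ((1 + |y|) ^ (1 - p - min 1 β) *
        if β = 1 then log (2 + |y|) else 1)) := by
  obtain ⟨C₀, hC₀, hB⟩ := exists_setLIntegral_one_add_rpow_le β
  have hβ0 : 0 < β := by linarith
  let C₁ : ℝ := (1 / 2) ^ (-β) * ((1 / 2) ^ (1 - p) / (1 - p))
  let C₂ : ℝ := (1 / 2) ^ (-p) * (2 * C₀)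
  let C₃ : ℝ := (1 / 2) ^ (-β) * (2 ^ (1 - p - β) / (p + β - 1))
  have hC₁ : 0 ≤ C₁ := mul_nonneg (by positivity) (div_nonneg (by positivity) (by linarith))
  have hC₂ : 0 ≤ C₂ := by positivity
  have hC₃ : 0 ≤ C₃ := mul_nonneg (by positivity) (div_nonneg (by positivity) (by linarith))
  refine ⟨2 * C₁ + C₂ + 2 * C₃, by positivity, fun y => ?_⟩
  set M := 1 + |y| with hM
  have hM1 : 1 ≤ M := by simp [hM]
  have hM0 : 0 < M := by linarith
  set L : ℝ := if β = 1 then log (2 + |y|) else 1 with hL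
  have hL2 : 1 ≤ 2 * L := one_le_two_mul_ite_log β y
  have hLB : (if β = 1 then log (1 + M) else 1) = L := by
    rw [hL, hM]
    ring_nf
  set P := M ^ (1 - p - min 1 β) with hP
  have hP0 : 0 ≤ P := by positivity
  have hMP : M ^ (1 - p - β) ≤ 2 * (P * L) := by
    have : M ^ (1 - p - β) ≤ P :=
      rpow_le_rpow_of_exponent_le hM1 (by linarith [min_le_right 1 β])
    nlinarith
  have hA : ∫⁻ u in Set.Ioc 0 (M / 2), ENNReal.ofReal (u ^ (-p) * (1 + |y - u|) ^ (-β)) ≤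
      ENNReal.ofReal (C₁ * M ^ (1 - p - β)) := by
    calc _ ≤ ∫⁻ u in Set.Ioc 0 (M / 2),
          ENNReal.ofReal ((M / 2) ^ (-β)) * ENNReal.ofReal (u ^ (-p)) := by
          refine setLIntegral_mono' measurableSet_Ioc fun u hu => ?_
          rw [← ENNReal.ofReal_mul (by positivity)]
          apply ENNReal.ofReal_le_ofReal
          rw [mul_comm]
          refine mul_le_mul_of_nonneg_right ?_ (rpow_nonneg hu.1.le _)
          refine rpow_le_rpow_of_nonpos (by positivity) ?_ (by linarith)
          have := abs_sub_abs_le_abs_sub y u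
          rw [abs_of_pos hu.1] at this
          linarith [hu.2]
      _ = _ := by
          rw [lintegral_const_mul _ (by fun_prop),
            setLIntegral_Ioc_rpow (by linarith) (by positivity),
            ← ENNReal.ofReal_mul (by positivity)]
          congr 1
          have e1 : (1 - p - β) = -β + (1 - p) := by ring
          rw [neg_add_eq_sub, div_eq_mul_one_div M 2, mul_rpow hM0.le (by norm_num),
            mul_rpow hM0.le (by norm_num), e1, rpow_add hM0]
          simp only [C₁]
          ring
  have hBB : ∫⁻ u in Set.Ioc (M / 2) (2 * M),
      ENNReal.ofReal (u ^ (-p) * (1 + |y - u|) ^ (-β)) ≤ ENNReal.ofReal (C₂ * (P * L)) := by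
    calc _ ≤ ∫⁻ u in Set.Ioc (M / 2) (2 * M),
          ENNReal.ofReal ((M / 2) ^ (-p)) * ENNReal.ofReal ((1 + |u - y|) ^ (-β)) := by
          refine setLIntegral_mono' measurableSet_Ioc fun u hu => ?_
          rw [← ENNReal.ofReal_mul (by positivity), abs_sub_comm]
          apply ENNReal.ofReal_le_ofReal
          refine mul_le_mul_of_nonneg_right ?_ (by positivity)
          exact rpow_le_rpow_of_nonpos (by positivity) hu.1.le (by linarith)
      _ ≤ ENNReal.ofReal ((M / 2) ^ (-p)) *
          (2 * ENNReal.ofReal (C₀ * (M ^ (1 - min 1 β) * L))) := by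
          rw [lintegral_const_mul _ (by fun_prop)]
          gcongr
          rw [← hLB]
          refine (setLIntegral_abs_sub_le (h := fun t => ENNReal.ofReal ((1 + t) ^ (-β)))
            (R := 3 * M) (by fun_prop) measurableSet_Ioc fun u hu => ?_).trans
            (mul_le_mul_right (hB M hM1) 2)
          rw [abs_le]
          constructor <;> linarith [hu.1, hu.2, neg_abs_le y, le_abs_self y]
      _ = _ := by
          rw [show (2 : ENNReal) = ENNReal.ofReal 2 by simp, ← ENNReal.ofReal_mul (by norm_num),
            ← ENNReal.ofReal_mul (by positivity)]
          congr 1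
          have e1 : 1 - p - min 1 β = -p + (1 - min 1 β) := by ring
          rw [hP, e1, rpow_add hM0, div_eq_mul_one_div M 2, mul_rpow hM0.le (by norm_num)]
          simp only [C₂]
          ring
  have hC : ∫⁻ u in Set.Ioi (2 * M), ENNReal.ofReal (u ^ (-p) * (1 + |y - u|) ^ (-β)) ≤
      ENNReal.ofReal (C₃ * M ^ (1 - p - β)) := by
    calc _ ≤ ∫⁻ u in Set.Ioi (2 * M),
          ENNReal.ofReal ((1 / 2) ^ (-β)) * ENNReal.ofReal (u ^ (-p - β)) := by
          refine setLIntegral_mono' measurableSet_Ioi fun u hu => ?_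
          have hu0 : 0 < u := by linarith [Set.mem_Ioi.1 hu]
          rw [← ENNReal.ofReal_mul (by positivity)]
          apply ENNReal.ofReal_le_ofReal
          have : (1 + |y - u|) ^ (-β) ≤ (1 / 2 * u) ^ (-β) := by
            refine rpow_le_rpow_of_nonpos (by positivity) ?_ (by linarith)
            linarith [neg_abs_le (y - u), le_abs_self y, Set.mem_Ioi.1 hu]
          calc _ ≤ u ^ (-p) * (1 / 2 * u) ^ (-β) := by gcongr
            _ = _ := by
              rw [mul_rpow (by norm_num) hu0.le, sub_eq_add_neg (-p), rpow_add hu0]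
              ring
      _ = _ := by
          rw [lintegral_const_mul _ (by fun_prop),
            setLIntegral_Ioi_rpow (by linarith) (by positivity),
            ← ENNReal.ofReal_mul (by positivity)]
          congr 1
          have e1 : -p - β + 1 = 1 - p - β := by ring
          have e2 : p + β - 1 ≠ 0 := by linarith
          have e3 : 1 - p - β = -(p + β - 1) := by ring
          rw [e1, mul_rpow (by norm_num) hM0.le]
          simp only [C₃]
          rw [e3]
          field_simp
  calc _ ≤ ∫⁻ u in Set.Ioc 0 (M / 2) ∪ (Set.Ioc (M / 2) (2 * M) ∪ Set.Ioi (2 * M)),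
        ENNReal.ofReal (u ^ (-p) * (1 + |y - u|) ^ (-β)) := by
        refine lintegral_mono_set fun u hu => ?_
        rcases le_or_gt u (M / 2) with h1 | h1
        · exact Or.inl ⟨hu, h1⟩
        · rcases le_or_gt u (2 * M) with h2 | h2
          · exact Or.inr (Or.inl ⟨h1, h2⟩)
          · exact Or.inr (Or.inr h2)
    _ ≤ ENNReal.ofReal (C₁ * M ^ (1 - p - β)) + (ENNReal.ofReal (C₂ * (P * L)) +
        ENNReal.ofReal (C₃ * M ^ (1 - p - β))) :=
        (lintegral_union_le _ _ _).trans (add_le_add hA ((lintegral_union_le _ _ _).trans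
          (add_le_add hBB hC)))
    _ ≤ _ := by
        have hL0 : 0 ≤ L := by linarith
        rw [← ENNReal.ofReal_add (by positivity) (by positivity),
          ← ENNReal.ofReal_add (by positivity) (by positivity)]
        apply ENNReal.ofReal_le_ofReal
        have i1 := mul_le_mul_of_nonneg_left hMP hC₁
        have i3 := mul_le_mul_of_nonneg_left hMP hC₃
        linarith

lemma setLIntegral_abs_sin_le {φ : ℝ → ENNReal} (hφ : Measurable φ)
    (hanti : AntitoneOn φ (Set.Ici 0)) :
    ∫⁻ b in Set.Icc (-π) π, φ |sin b| ≤ 6 * ∫⁻ t in Set.Ioc 0 (2 * π), φ (t / 2) := by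
  have hcomp : ∀ t : ℝ, |t| ≤ π / 2 → φ |sin t| ≤ φ (|t| / 2) := by
    intro t ht
    refine hanti (Set.mem_Ici.2 (by positivity)) (Set.mem_Ici.2 (by positivity)) ?_
    refine le_trans ?_ (mul_abs_le_abs_sin ht)
    have : (1 : ℝ) / 2 ≤ 2 / π := by
      rw [div_le_div_iff₀ (by norm_num) pi_pos]
      linarith [pi_le_four]
    calc |t| / 2 = 1 / 2 * |t| := by ring
      _ ≤ _ := by gcongr
  have hpt : ∀ b ∈ Set.Icc (-π) π,
      φ |sin b| ≤ φ (|b - 0| / 2) + (φ (|b - π| / 2) + φ (|b - -π| / 2)) := by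
    intro b hb
    rcases le_or_gt b (-(π / 2)) with h1 | h1
    · have h := hcomp (b - -π) (abs_le.2 ⟨by linarith [hb.1, pi_pos], by linarith⟩)
      rw [sub_neg_eq_add, sin_add_pi, abs_neg, ← sub_neg_eq_add] at h
      exact h.trans (le_add_self.trans le_add_self)
    · rcases le_or_gt b (π / 2) with h2 | h2
      · have h := hcomp b (abs_le.2 ⟨h1.le, h2⟩)
        rw [sub_zero]
        exact h.trans le_self_add
      · have h := hcomp (b - π) (abs_le.2 ⟨by linarith, by linarith [hb.2, pi_pos]⟩)
        rw [sin_sub_pi, abs_neg] at h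
        exact h.trans (le_self_add.trans le_add_self)
  have hshift : ∀ y : ℝ, |y| ≤ π → ∫⁻ b in Set.Icc (-π) π, φ (|b - y| / 2) ≤
      2 * ∫⁻ t in Set.Ioc 0 (2 * π), φ (t / 2) := by
    intro y hy
    refine setLIntegral_abs_sub_le (h := fun t => φ (t / 2)) (by fun_prop) measurableSet_Icc
      fun u hu => ?_
    rw [abs_le] at hy ⊢
    constructor <;> linarith [hu.1, hu.2, hy.1, hy.2]
  calc _ ≤ ∫⁻ b in Set.Icc (-π) π,
        (φ (|b - 0| / 2) + (φ (|b - π| / 2) + φ (|b - -π| / 2))) :=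
        setLIntegral_mono' measurableSet_Icc hpt
    _ = (∫⁻ b in Set.Icc (-π) π, φ (|b - 0| / 2)) + ((∫⁻ b in Set.Icc (-π) π, φ (|b - π| / 2)) +
        ∫⁻ b in Set.Icc (-π) π, φ (|b - -π| / 2)) := by
        rw [lintegral_add_left (by fun_prop), lintegral_add_left (by fun_prop)]
    _ ≤ _ := add_le_add (hshift 0 (by simpa using pi_pos.le)) (add_le_add
        (hshift π (by rw [abs_of_pos pi_pos])) (hshift (-π) (by rw [abs_neg, abs_of_pos pi_pos])))
    _ = _ := by ring

lemma setLIntegral_add_sin_sq_rpow_le {p S : ℝ} (hp : 0 ≤ p) (hS : 0 < S) :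
    ∫⁻ b in Set.Icc (-π) π, ENNReal.ofReal ((S ^ 2 + sin b ^ 2) ^ (-p)) ≤
      6 * ∫⁻ t in Set.Ioc 0 (2 * π), ENNReal.ofReal ((S ^ 2 + (t / 2) ^ 2) ^ (-p)) := by
  refine le_trans (le_of_eq ?_)
    (setLIntegral_abs_sin_le (φ := fun t => ENNReal.ofReal ((S ^ 2 + t ^ 2) ^ (-p)))
      (by fun_prop) ?_)
  · simp only [sq_abs]
  · intro s hs t _ hst
    apply ENNReal.ofReal_le_ofReal
    refine rpow_le_rpow_of_nonpos (by positivity) ?_ (by linarith)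
    gcongr

lemma exists_setLIntegral_add_sin_sq_rpow_le {p : ℝ} (hp : 1 / 2 < p) :
    ∃ C : ℝ, 0 ≤ C ∧ ∀ S : ℝ, 0 < S →
      ∫⁻ b in Set.Icc (-π) π, ENNReal.ofReal ((S ^ 2 + sin b ^ 2) ^ (-p)) ≤
        ENNReal.ofReal (C * S ^ (1 - 2 * p)) := by
  let C₁ : ℝ := (1 / 2) ^ (-(2 * p)) * (1 / (2 * p - 1))
  have hC₁ : 0 ≤ C₁ := mul_nonneg (by positivity) (div_nonneg (by norm_num) (by linarith))
  refine ⟨6 * (1 + C₁), by positivity, fun S hS => ?_⟩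
  have hsq : ∀ x : ℝ, 0 ≤ x → (x ^ 2) ^ (-p) = x ^ (-(2 * p)) := by
    intro x hx
    rw [← rpow_natCast, ← rpow_mul hx]
    congr 1
    push_cast
    ring
  have hA : ∫⁻ t in Set.Ioc 0 S, ENNReal.ofReal ((S ^ 2 + (t / 2) ^ 2) ^ (-p)) ≤
      ENNReal.ofReal (S ^ (1 - 2 * p)) := by
    calc _ ≤ ∫⁻ _ in Set.Ioc 0 S, ENNReal.ofReal (S ^ (-(2 * p))) := by
          refine lintegral_mono fun t => ENNReal.ofReal_le_ofReal ?_
          rw [← hsq S hS.le]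
          exact rpow_le_rpow_of_nonpos (by positivity) (by nlinarith [sq_nonneg t]) (by linarith)
      _ = _ := by
          rw [setLIntegral_const, Real.volume_Ioc, ← ENNReal.ofReal_mul (by positivity),
            sub_zero]
          congr 1
          rw [show 1 - 2 * p = -(2 * p) + 1 by ring, rpow_add_one hS.ne']
  have hB : ∫⁻ t in Set.Ioi S, ENNReal.ofReal ((S ^ 2 + (t / 2) ^ 2) ^ (-p)) ≤
      ENNReal.ofReal (C₁ * S ^ (1 - 2 * p)) := by
    calc _ ≤ ∫⁻ t in Set.Ioi S,
          ENNReal.ofReal ((1 / 2) ^ (-(2 * p))) * ENNReal.ofReal (t ^ (-(2 * p))) := by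
          refine setLIntegral_mono' measurableSet_Ioi fun t ht => ?_
          have ht0 : 0 < t := hS.trans ht
          rw [← ENNReal.ofReal_mul (by positivity), ← mul_rpow (by norm_num) ht0.le,
            ← hsq _ (by positivity)]
          refine ENNReal.ofReal_le_ofReal
            (rpow_le_rpow_of_nonpos (by positivity) ?_ (by linarith))
          nlinarith [sq_nonneg S]
      _ = _ := by
          rw [lintegral_const_mul _ (by fun_prop), setLIntegral_Ioi_rpow (by linarith) hS,
            ← ENNReal.ofReal_mul (by positivity)]
          congr 1
          have e1 : -(2 * p) + 1 = 1 - 2 * p := by ring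
          have e2 : 2 * p - 1 ≠ 0 := by linarith
          have e3 : 1 - 2 * p = -(2 * p - 1) := by ring
          simp only [C₁]
          rw [e1, e3]
          field_simp
  calc _ ≤ _ := setLIntegral_add_sin_sq_rpow_le (by linarith) hS
    _ ≤ 6 * ∫⁻ t in Set.Ioc 0 S ∪ Set.Ioi S, ENNReal.ofReal ((S ^ 2 + (t / 2) ^ 2) ^ (-p)) := by
        gcongr
        intro t ht
        rcases le_or_gt t S with h | h
        · exact Or.inl ⟨ht.1, h⟩
        · exact Or.inr h
    _ ≤ 6 * (ENNReal.ofReal (S ^ (1 - 2 * p)) + ENNReal.ofReal (C₁ * S ^ (1 - 2 * p))) := by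
        gcongr
        exact (lintegral_union_le _ _ _).trans (add_le_add hA hB)
    _ = _ := by
        rw [← ENNReal.ofReal_add (by positivity) (by positivity),
          show (6 : ENNReal) = ENNReal.ofReal 6 by simp, ← ENNReal.ofReal_mul (by norm_num)]
        congr 1
        ring

lemma setLIntegral_add_sin_sq_rpow_neg_half_le {S ε : ℝ} (hS : 0 < S) (hε : 0 < ε)
    (hε1 : ε ≤ 1) :
    ∫⁻ b in Set.Icc (-π) π, ENNReal.ofReal ((S ^ 2 + sin b ^ 2) ^ (-(1 / 2) : ℝ)) ≤
      ENNReal.ofReal (24 * π / ε * S ^ (-ε)) := by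
  have hsq : ∀ x c : ℝ, 0 ≤ x → (x ^ 2) ^ (-(c / 2)) = x ^ (-c) := by
    intro x c hx
    rw [← rpow_natCast, ← rpow_mul hx]
    congr 1
    push_cast
    ring
  calc _ ≤ _ := setLIntegral_add_sin_sq_rpow_le (by norm_num) hS
    _ ≤ 6 * ∫⁻ t in Set.Ioc 0 (2 * π),
        ENNReal.ofReal (S ^ (-ε) * 2) * ENNReal.ofReal (t ^ (ε - 1)) := by
        gcongr 6 * ?_
        refine setLIntegral_mono' measurableSet_Ioc fun t ht => ?_
        have ht0 : 0 < t := ht.1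
        rw [← ENNReal.ofReal_mul (by positivity)]
        apply ENNReal.ofReal_le_ofReal
        have h1 : (S ^ 2 + (t / 2) ^ 2) ^ (-(ε / 2)) ≤ S ^ (-ε) := by
          rw [← hsq S ε hS.le]
          exact rpow_le_rpow_of_nonpos (by positivity) (by nlinarith [sq_nonneg t])
            (by linarith)
        have h2 : (S ^ 2 + (t / 2) ^ 2) ^ (-((1 - ε) / 2)) ≤ 2 * t ^ (ε - 1) := by
          calc _ ≤ ((t / 2) ^ 2) ^ (-((1 - ε) / 2)) :=
                rpow_le_rpow_of_nonpos (by positivity) (by nlinarith [sq_nonneg S])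
                  (by linarith)
            _ = 2 ^ (1 - ε) * t ^ (ε - 1) := by
                rw [hsq _ _ (by positivity), div_rpow ht0.le (by norm_num),
                  rpow_neg (by norm_num : (0 : ℝ) ≤ 2), div_inv_eq_mul, mul_comm, neg_sub]
            _ ≤ 2 ^ (1 : ℝ) * t ^ (ε - 1) := by
                gcongr
                · norm_num
                · linarith
            _ = _ := by rw [rpow_one]
        rw [show (-(1 / 2) : ℝ) = -(ε / 2) + -((1 - ε) / 2) by ring,
          rpow_add (by positivity), mul_assoc]
        gcongr
    _ = 6 * ENNReal.ofReal (S ^ (-ε) * 2 * ((2 * π) ^ ε / ε)) := by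
        rw [lintegral_const_mul _ (by fun_prop),
          setLIntegral_Ioc_rpow (by linarith) (by positivity),
          ← ENNReal.ofReal_mul (by positivity), sub_add_cancel]
    _ ≤ _ := by
        rw [show (6 : ENNReal) = ENNReal.ofReal 6 by simp, ← ENNReal.ofReal_mul (by norm_num)]
        apply ENNReal.ofReal_le_ofReal
        have h1 : (2 * π) ^ ε ≤ 2 * π := by
          calc (2 * π) ^ ε ≤ (2 * π) ^ (1 : ℝ) :=
                rpow_le_rpow_of_exponent_le (by linarith [pi_gt_three]) hε1
            _ = _ := rpow_one _
        calc _ ≤ 6 * (S ^ (-ε) * 2 * (2 * π / ε)) := by gcongr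
          _ = _ := by ring

lemma exists_setLIntegral_add_sin_sq_rpow_le_of_le {p : ℝ} (hp : 1 / 2 ≤ p) :
    ∃ C : ℝ, 0 ≤ C ∧ ∀ K : ℝ, 2 ≤ K → ∀ S u : ℝ, 0 < S → 0 < u → u ≤ K * S ^ 2 →
      ∫⁻ b in Set.Icc (-π) π, ENNReal.ofReal ((S ^ 2 + sin b ^ 2) ^ (-p)) ≤
        ENNReal.ofReal (C * (if p = 1 / 2 then log K else 1) * K ^ p *
          (S * (u ^ (-p) + if u ≤ 1 then u ^ (-(3 / 4) : ℝ) else 0))) := by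
  have hite : ∀ u : ℝ, 0 < u → (0 : ℝ) ≤ if u ≤ 1 then u ^ (-(3 / 4) : ℝ) else 0 := by
    intro u hu
    split_ifs <;> positivity
  have hpow : ∀ K S u q : ℝ, 0 < K → 0 < S → 0 < u → u ≤ K * S ^ 2 → 0 ≤ q →
      S ^ (-(2 * q)) ≤ K ^ q * u ^ (-q) := by
    intro K S u q hK hS hu huS hq
    calc S ^ (-(2 * q)) = (S ^ 2) ^ (-q) := by
          rw [← rpow_natCast, ← rpow_mul hS.le]
          congr 1
          push_cast
          ring
      _ ≤ (u / K) ^ (-q) := by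
          refine rpow_le_rpow_of_nonpos (by positivity) ?_ (by linarith)
          rwa [div_le_iff₀' hK]
      _ = _ := by
          rw [div_rpow hu.le hK.le, rpow_neg hK.le, div_inv_eq_mul, mul_comm]
  rcases hp.eq_or_lt with rfl | hp
  · refine ⟨24 * π * 4 * 2, by positivity, fun K hK S u hS hu huS => ?_⟩
    have hK0 : 0 < K := by linarith
    have hlog : 1 / 2 ≤ log K := by
      have : log 2 ≤ log K := log_le_log (by norm_num) hK
      linarith [Real.log_two_gt_d9]
    have hlog0 : 0 < log K := by linarith
    set ε := 1 / (4 * log K) with hε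
    have hε0 : 0 < ε := by positivity
    have hε1 : ε ≤ 1 / 2 := by
      rw [hε, div_le_div_iff₀ (by positivity) (by norm_num)]
      linarith
    refine (setLIntegral_add_sin_sq_rpow_neg_half_le hS hε0 (by linarith)).trans
      (ENNReal.ofReal_le_ofReal ?_)
    rw [if_pos rfl]
    have h1 : S ^ (-ε) = S * S ^ (-(2 * ((1 + ε) / 2))) := by
      rw [← rpow_one_add' hS.le (by ring_nf; linarith)]
      congr 1
      ring
    have h2 := hpow K S u ((1 + ε) / 2) hK0 hS hu huS (by linarith)
    have h3 : K ^ ((1 + ε) / 2) ≤ 2 * K ^ (1 / 2 : ℝ) := by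
      rw [show (1 + ε) / 2 = ε / 2 + 1 / 2 by ring, rpow_add hK0]
      gcongr
      rw [rpow_def_of_pos hK0]
      have : log K * (ε / 2) = 1 / 8 := by
        rw [hε]
        field_simp
        norm_num
      rw [this, ← le_log_iff_exp_le (by norm_num)]
      linarith [Real.log_two_gt_d9]
    have h4 : u ^ (-((1 + ε) / 2)) ≤
        u ^ (-(1 / 2) : ℝ) + if u ≤ 1 then u ^ (-(3 / 4) : ℝ) else 0 := by
      split_ifs with hu1
      · have : u ^ (-((1 + ε) / 2)) ≤ u ^ (-(3 / 4) : ℝ) :=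
          rpow_le_rpow_of_exponent_ge hu hu1 (by linarith)
        have h0 : 0 ≤ u ^ (-(1 / 2) : ℝ) := by positivity
        linarith
      · rw [add_zero]
        exact rpow_le_rpow_of_exponent_le (not_le.1 hu1).le (by linarith)
    have hε' : 24 * π / ε = 24 * π * 4 * log K := by
      rw [hε]
      field_simp
    rw [h1, hε']
    calc 24 * π * 4 * log K * (S * S ^ (-(2 * ((1 + ε) / 2))))
        ≤ 24 * π * 4 * log K * (S * ((2 * K ^ (1 / 2 : ℝ)) *
          (u ^ (-(1 / 2) : ℝ) + if u ≤ 1 then u ^ (-(3 / 4) : ℝ) else 0))) := by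
          gcongr
          refine h2.trans ?_
          gcongr
      _ = _ := by ring
  · obtain ⟨C, hC, h⟩ := exists_setLIntegral_add_sin_sq_rpow_le hp
    refine ⟨C, hC, fun K hK S u hS hu huS => (h S hS).trans (ENNReal.ofReal_le_ofReal ?_)⟩
    have hK0 : 0 < K := by linarith
    rw [if_neg hp.ne', mul_one, mul_assoc]
    gcongr
    have h1 : S ^ (1 - 2 * p) = S * S ^ (-(2 * p)) := by
      rw [← rpow_one_add' hS.le (by ring_nf; linarith)]
      congr 1
    rw [h1]
    calc S * S ^ (-(2 * p)) ≤ S * (K ^ p * u ^ (-p)) := by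
          gcongr
          exact hpow K S u p hK0 hS hu huS (by linarith)
      _ = K ^ p * (S * (u ^ (-p) + 0)) := by ring
      _ ≤ _ := by
          gcongr
          exact hite u hu

lemma exists_setLIntegral_weight_mul_le {p β : ℝ} (hp0 : 0 ≤ p) (hp : p < 1)
    (hβ : 1 - p < β) : ∃ C : ℝ, 0 ≤ C ∧ ∀ y : ℝ,
    ∫⁻ u in Set.Ioi 0, ENNReal.ofReal ((u ^ (-p) + if u ≤ 1 then u ^ (-(3 / 4) : ℝ) else 0) *
      (1 + |y - u|) ^ (-β)) ≤
      ENNReal.ofReal (C * ((1 + |y|) ^ (1 - p - min 1 β) *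
        if β = 1 then log (2 + |y|) else 1)) := by
  obtain ⟨C, hC, h⟩ := exists_setLIntegral_rpow_mul_le hp0 hp hβ
  have hβ0 : 0 < β := by linarith
  refine ⟨C + 8 * (1 / 2) ^ (-β), by positivity, fun y => ?_⟩
  set M := 1 + |y| with hM
  have hM1 : 1 ≤ M := by simp [hM]
  have hM0 : 0 < M := by linarith
  set L : ℝ := if β = 1 then log (2 + |y|) else 1 with hL
  have hL2 : 1 ≤ 2 * L := one_le_two_mul_ite_log β y
  set P := M ^ (1 - p - min 1 β) with hP
  have hP0 : 0 ≤ P := by positivity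
  have hMP : M ^ (-β) ≤ 2 * (P * L) := by
    have : M ^ (-β) ≤ P :=
      rpow_le_rpow_of_exponent_le hM1 (by linarith [min_le_right 1 β])
    nlinarith
  have hnear : ∫⁻ u in Set.Ioc 0 1,
      ENNReal.ofReal (u ^ (-(3 / 4) : ℝ) * (1 + |y - u|) ^ (-β)) ≤
      ENNReal.ofReal (4 * (1 / 2) ^ (-β) * M ^ (-β)) := by
    calc _ ≤ ∫⁻ u in Set.Ioc (0 : ℝ) 1,
          ENNReal.ofReal ((1 / 2 * M) ^ (-β)) * ENNReal.ofReal (u ^ (-(3 / 4) : ℝ)) := by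
          refine setLIntegral_mono' measurableSet_Ioc fun u hu => ?_
          rw [← ENNReal.ofReal_mul (by positivity), mul_comm]
          apply ENNReal.ofReal_le_ofReal
          refine mul_le_mul_of_nonneg_right ?_ (rpow_nonneg hu.1.le _)
          refine rpow_le_rpow_of_nonpos (by positivity) ?_ (by linarith)
          have := abs_sub_abs_le_abs_sub y u
          rw [abs_of_pos hu.1] at this
          linarith [hu.2, abs_nonneg (y - u)]
      _ = _ := by
          rw [lintegral_const_mul _ (by fun_prop),
            setLIntegral_Ioc_rpow (by norm_num) (by norm_num),
            ← ENNReal.ofReal_mul (by positivity), mul_rpow (by norm_num) hM0.le, one_rpow]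
          congr 1
          norm_num
          ring
  have hsplit : ∀ u ∈ Set.Ioi (0 : ℝ),
      ENNReal.ofReal ((u ^ (-p) + if u ≤ 1 then u ^ (-(3 / 4) : ℝ) else 0) *
        (1 + |y - u|) ^ (-β)) ≤ ENNReal.ofReal (u ^ (-p) * (1 + |y - u|) ^ (-β)) +
        (Set.Iic (1 : ℝ)).indicator
          (fun u => ENNReal.ofReal (u ^ (-(3 / 4) : ℝ) * (1 + |y - u|) ^ (-β))) u := by
    intro u _
    rw [add_mul]
    refine ENNReal.ofReal_add_le.trans (add_le_add le_rfl ?_)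
    by_cases hu1 : u ≤ 1
    · rw [if_pos hu1, Set.indicator_of_mem (Set.mem_Iic.2 hu1)]
    · rw [if_neg hu1]
      simp
  calc _ ≤ _ := setLIntegral_mono' measurableSet_Ioi hsplit
    _ = (∫⁻ u in Set.Ioi 0, ENNReal.ofReal (u ^ (-p) * (1 + |y - u|) ^ (-β))) +
        ∫⁻ u in Set.Ioc 0 1, ENNReal.ofReal (u ^ (-(3 / 4) : ℝ) * (1 + |y - u|) ^ (-β)) := by
        rw [lintegral_add_left (by fun_prop), lintegral_indicator measurableSet_Iic,
          Measure.restrict_restrict measurableSet_Iic, Set.inter_comm, Set.Ioi_inter_Iic]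
    _ ≤ _ := add_le_add (h y) hnear
    _ ≤ _ := by
        have hL0 : 0 ≤ L := by linarith
        rw [← ENNReal.ofReal_add (by positivity) (by positivity)]
        apply ENNReal.ofReal_le_ofReal
        have i1 := mul_le_mul_of_nonneg_left hMP
          (by positivity : (0 : ℝ) ≤ 4 * (1 / 2) ^ (-β))
        linarith

lemma exists_lintegral_complex_le {α β : ℝ} (hα1 : 3 / 2 ≤ α) (hα2 : α < 2)
    (hβ : 2 - α < β) : ∃ C : ℝ, 0 ≤ C ∧ ∀ w : ℂ, 2 ≤ ‖w‖ → ∀ Y : ℝ,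
    ∫⁻ x : ℂ, ENNReal.ofReal
        (‖x‖ ^ (-α) * ‖w - x‖ ^ (-α) * (1 + |Y - ‖x‖ - ‖w - x‖|) ^ (-β)) ≤
      ENNReal.ofReal (C * ‖w‖ ^ (-α) * (if α = 3 / 2 then log ‖w‖ else 1) *
        (1 + |Y - ‖w‖|) ^ (2 - α - min 1 β) *
        (if β = 1 then log (2 + |Y - ‖w‖|) else 1)) := by
  obtain ⟨p, rfl⟩ : ∃ p, α = p + 1 := ⟨α - 1, by ring⟩
  obtain ⟨C₁, hC₁, h₁⟩ := exists_setLIntegral_add_sin_sq_rpow_le_of_le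
    (p := p) (by linarith)
  obtain ⟨C₂, hC₂, h₂⟩ := exists_setLIntegral_weight_mul_le (p := p) (β := β)
    (by linarith) (by linarith) (by linarith)
  refine ⟨2 ^ (2 * p) * C₁ * C₂, by positivity, fun w hw Y => ?_⟩
  set K := ‖w‖ with hK
  have hK0 : 0 < K := by linarith
  have hw0 : w ≠ 0 := norm_pos_iff.1 hK0
  set y := Y - K with hy
  have hif : (if p + 1 = 3 / 2 then log K else 1) = if p = 1 / 2 then log K else 1 :=
    if_congr ⟨fun h => by linarith, fun h => by linarith⟩ rfl rfl
  rw [hif, show 2 - (p + 1) - min 1 β = 1 - p - min 1 β by ring]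
  set l : ℝ := if p = 1 / 2 then log K else 1 with hl
  have hl0 : 0 ≤ l := by
    rw [hl]
    split_ifs
    · exact log_nonneg (by linarith)
    · norm_num
  let U : ℝ → ℝ := fun a => K * (cosh a - 1)
  let W : ℝ → ENNReal := fun u => ENNReal.ofReal
    ((u ^ (-p) + if u ≤ 1 then u ^ (-(3 / 4) : ℝ) else 0) * (1 + |y - u|) ^ (-β))
  have hWm : Measurable W := by
    have : Measurable fun u : ℝ => if u ≤ 1 then u ^ (-(3 / 4) : ℝ) else 0 :=
      Measurable.ite measurableSet_Iic (by fun_prop) measurable_const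
    fun_prop
  have hU0 : ∀ a ∈ Set.Ioi (0 : ℝ), 0 < U a := fun a ha =>
    mul_pos hK0 (sub_pos.2 (one_lt_cosh.2 (ne_of_gt ha)))
  have hpt : ∀ a ∈ Set.Ioi (0 : ℝ), ∀ b : ℝ,
      ENNReal.ofReal ((K / 2) ^ 2 * (sinh a ^ 2 + sin b ^ 2)) *
        ENNReal.ofReal ((K / 2 * (cosh a + cos b)) ^ (-(p + 1)) *
          (K / 2 * (cosh a - cos b)) ^ (-(p + 1)) *
          (1 + |Y - K / 2 * (cosh a + cos b) - K / 2 * (cosh a - cos b)|) ^ (-β)) =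
      ENNReal.ofReal ((K / 2) ^ (-(2 * p)) * (1 + |y - U a|) ^ (-β)) *
        ENNReal.ofReal ((sinh a ^ 2 + sin b ^ 2) ^ (-p)) := by
    intro a ha b
    have hc : 1 < cosh a := one_lt_cosh.2 (ne_of_gt ha)
    have hs : 0 < sinh a := sinh_pos_iff.2 ha
    have hN : 0 < sinh a ^ 2 + sin b ^ 2 := by positivity
    have hd : 0 ≤ cosh a + cos b := by linarith [neg_one_le_cos b]
    have hd' : 0 ≤ cosh a - cos b := by linarith [cos_le_one b]
    rw [← ENNReal.ofReal_mul (by positivity), ← ENNReal.ofReal_mul (by positivity)]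
    congr 1
    have e1 : Y - K / 2 * (cosh a + cos b) - K / 2 * (cosh a - cos b) = y - U a := by
      simp only [U, hy]
      ring
    have e2 : (K / 2 * (cosh a + cos b)) * (K / 2 * (cosh a - cos b)) =
        (K / 2) ^ 2 * (sinh a ^ 2 + sin b ^ 2) := by
      linear_combination (K / 2) ^ 2 * (cosh_sq a - sin_sq_add_cos_sq b)
    have e3 : ((K / 2) ^ 2) ^ (-p) = (K / 2) ^ (-(2 * p)) := by
      rw [← rpow_natCast, ← rpow_mul (by positivity)]
      congr 1
      push_cast
      ring
    have e4 : (K / 2) ^ 2 * (sinh a ^ 2 + sin b ^ 2) *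
        ((K / 2) ^ 2 * (sinh a ^ 2 + sin b ^ 2)) ^ (-(p + 1)) =
        (K / 2) ^ (-(2 * p)) * (sinh a ^ 2 + sin b ^ 2) ^ (-p) := by
      rw [← e3, ← mul_rpow (by positivity) hN.le, ← rpow_one_add' (by positivity)]
      · congr 1
        ring
      · linarith
    rw [e1, ← mul_rpow (by positivity) (by positivity), e2, ← mul_assoc, e4]
    ring
  have hinner : ∀ a ∈ Set.Ioi (0 : ℝ), ∫⁻ b in Set.Icc (-π) π,
      ENNReal.ofReal ((K / 2) ^ 2 * (sinh a ^ 2 + sin b ^ 2)) *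
        ENNReal.ofReal ((K / 2 * (cosh a + cos b)) ^ (-(p + 1)) *
          (K / 2 * (cosh a - cos b)) ^ (-(p + 1)) *
          (1 + |Y - K / 2 * (cosh a + cos b) - K / 2 * (cosh a - cos b)|) ^ (-β)) ≤
      ENNReal.ofReal (2 ^ (2 * p) * C₁ * K ^ (-(p + 1)) * l) *
        (ENNReal.ofReal |K * sinh a| * W (U a)) := by
    intro a ha
    have hs : 0 < sinh a := sinh_pos_iff.2 ha
    rw [lintegral_congr (hpt a ha), lintegral_const_mul _ (by fun_prop)]
    calc _ ≤ ENNReal.ofReal ((K / 2) ^ (-(2 * p)) * (1 + |y - U a|) ^ (-β)) *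
          ENNReal.ofReal (C₁ * l * K ^ p * (sinh a *
            (U a ^ (-p) + if U a ≤ 1 then U a ^ (-(3 / 4) : ℝ) else 0))) := by
          gcongr
          refine h₁ K hw (sinh a) (U a) hs (hU0 a ha) ?_
          simp only [U]
          gcongr
          nlinarith [cosh_sq a, one_le_cosh a]
      _ = _ := by
          rw [← ENNReal.ofReal_mul (by positivity), ← ENNReal.ofReal_mul (by positivity),
            ← ENNReal.ofReal_mul (by positivity), abs_of_pos (mul_pos hK0 hs)]
          congr 1
          have e1 : (K / 2) ^ (-(2 * p)) * K ^ p = 2 ^ (2 * p) * K ^ (-(p + 1)) * K := by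
            rw [div_rpow hK0.le (by norm_num), rpow_neg (by norm_num : (0 : ℝ) ≤ 2),
              div_inv_eq_mul, mul_right_comm, ← rpow_add hK0, mul_comm, mul_assoc,
              ← rpow_add_one hK0.ne']
            congr 2
            ring
          linear_combination (C₁ * l * sinh a * (1 + |y - U a|) ^ (-β) *
            (U a ^ (-p) + if U a ≤ 1 then U a ^ (-(3 / 4) : ℝ) else 0)) * e1
  have hchange : ∫⁻ a in Set.Ioi (0 : ℝ), ENNReal.ofReal |K * sinh a| * W (U a) ≤
      ∫⁻ u in Set.Ioi 0, W u := by
    rw [← lintegral_image_eq_lintegral_abs_deriv_mul (f := U) measurableSet_Ioi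
      (fun a _ => (((hasDerivAt_cosh a).sub_const 1).const_mul K).hasDerivWithinAt)]
    · exact lintegral_mono_set (Set.image_subset_iff.2 hU0)
    · intro a ha b hb hab
      have : cosh a = cosh b := by
        have := mul_left_cancel₀ hK0.ne' hab
        linarith
      exact cosh_strictMonoOn.injOn (Set.mem_Ici.2 (le_of_lt ha)) (Set.mem_Ici.2 (le_of_lt hb))
        this
  have hm : Measurable fun a => ENNReal.ofReal |K * sinh a| * W (U a) := by
    have hUm : Measurable U := by fun_prop
    exact Measurable.mul (by fun_prop) (hWm.comp hUm)
  calc _ ≤ _ := lintegral_norm_norm_sub_le hw0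
        (Q := fun r s => ENNReal.ofReal (r ^ (-(p + 1)) * s ^ (-(p + 1)) *
          (1 + |Y - r - s|) ^ (-β))) (by unfold Function.uncurry; fun_prop)
    _ ≤ ∫⁻ a in Set.Ioi (0 : ℝ), ENNReal.ofReal (2 ^ (2 * p) * C₁ * K ^ (-(p + 1)) * l) *
        (ENNReal.ofReal |K * sinh a| * W (U a)) := setLIntegral_mono' measurableSet_Ioi hinner
    _ ≤ ENNReal.ofReal (2 ^ (2 * p) * C₁ * K ^ (-(p + 1)) * l) *
        ENNReal.ofReal (C₂ * ((1 + |y|) ^ (1 - p - min 1 β) *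
          if β = 1 then log (2 + |y|) else 1)) := by
        rw [lintegral_const_mul _ hm]
        gcongr
        exact hchange.trans (h₂ y)
    _ = _ := by
        rw [← ENNReal.ofReal_mul (by positivity)]
        congr 1
        ring

/-- Lemma (planar integral estimate, case `3/2 ≤ α < 2`, `β > 2−α`). -/
theorem planar_integral_estimate_one
    (α β : ℝ) (hα1 : 3 / 2 ≤ α) (hα2 : α < 2) (hβ : 2 - α < β) :
    ∃ C : ℝ, ∀ k : EuclideanSpace ℝ (Fin 2), 2 ≤ ‖k‖ → ∀ Y : ℝ,
      (∫ x : EuclideanSpace ℝ (Fin 2),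
          ‖x‖ ^ (-α) * ‖k - x‖ ^ (-α) * (1 + |Y - ‖x‖ - ‖k - x‖|) ^ (-β))
        ≤ C * ‖k‖ ^ (-α) * (if α = 3 / 2 then Real.log ‖k‖ else 1) *
            (1 + |Y - ‖k‖|) ^ (2 - α - min 1 β) *
            (if β = 1 then Real.log (2 + |Y - ‖k‖|) else 1) := by
  obtain ⟨C, hC, h⟩ := exists_lintegral_complex_le hα1 hα2 hβ
  refine ⟨C, fun k hk Y => ?_⟩
  let e : ℂ ≃ₗᵢ[ℝ] EuclideanSpace ℝ (Fin 2) := Complex.orthonormalBasisOneI.repr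
  have hle := h (e.symm k) (by rwa [e.symm.norm_map]) Y
  have hsub : ∀ x : ℂ, ‖e.symm k - x‖ = ‖k - e x‖ := by
    intro x
    rw [← e.norm_map (e.symm k - x), map_sub, e.apply_symm_apply]
  simp_rw [hsub, e.symm.norm_map] at hle
  rw [integral_eq_lintegral_of_nonneg_ae (.of_forall fun x => by positivity)
    (by fun_prop : Measurable _).aestronglyMeasurable]
  have hLk : (0 : ℝ) ≤ if α = 3 / 2 then Real.log ‖k‖ else 1 := by
    split_ifs
    · exact log_nonneg (by linarith)
    · norm_num
  have hLY : (0 : ℝ) ≤ if β = 1 then Real.log (2 + |Y - ‖k‖|) else 1 := by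
    linarith [one_le_two_mul_ite_log β (Y - ‖k‖)]
  refine ENNReal.toReal_le_of_le_ofReal (by positivity) (le_trans (le_of_eq ?_) hle)
  rw [← e.measurePreserving.lintegral_comp (by fun_prop)]
  simp_rw [e.norm_map]
end

section
/- Let 3/2 < α < 2 and 0 ≤ β ≤ 2−α. Then there exists a constant C (depending only on α and β) such that for every k ∈ ℝ² with |k| ≥ 2 and every Y ∈ ℝ: ∫_{ℝ²} |x|^{−α} |k−x|^{−α} (1+|Y−|x|−|k−x||)^{−β} dx ≤ C·|k|^{2−2α−β}·L(|k|), where L(|k|) = log|k| if 2−α = β and L(|k|) = 1 if 2−α ≠ β. -/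
open MeasureTheory Real

theorem integral_one_add_mul_sin_sq_rpow_le {β : ℝ} (hβ0 : 0 ≤ β) (hβ : β < 1 / 2) {m : ℝ}
    (hm : 0 < m) :
    ∫ u in (-π)..π, (1 + m * sin (u / 2) ^ 2) ^ (-β) ≤
      2 * (π ^ (2 * β) * (π ^ (1 - 2 * β) / (1 - 2 * β))) * m ^ (-β) := by
  have hcont : Continuous fun u : ℝ => (1 + m * sin (u / 2) ^ 2) ^ (-β) := by
    refine Continuous.rpow_const (by fun_prop) fun u => Or.inl ?_
    positivity
  have hhalf : ∫ u in (0 : ℝ)..π, (1 + m * sin (u / 2) ^ 2) ^ (-β) ≤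
      ∫ u in (0 : ℝ)..π, m ^ (-β) * π ^ (2 * β) * u ^ (-(2 * β)) := by
    refine intervalIntegral.integral_mono_on_of_le_Ioo pi_pos.le (hcont.intervalIntegrable _ _)
      ((intervalIntegral.intervalIntegrable_rpow' (by linarith)).const_mul _) fun u hu => ?_
    have hsin : u / π ≤ sin (u / 2) := by
      have := mul_le_sin (x := u / 2) (by linarith [hu.1]) (by linarith [hu.2])
      calc u / π = 2 / π * (u / 2) := by ring
        _ ≤ _ := this
    have hup : 0 < u / π := div_pos hu.1 pi_pos
    calc (1 + m * sin (u / 2) ^ 2) ^ (-β) ≤ (m * (u / π) ^ 2) ^ (-β) := by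
          refine rpow_le_rpow_of_nonpos (by positivity) ?_ (by linarith)
          have : (u / π) ^ 2 ≤ sin (u / 2) ^ 2 := by gcongr
          nlinarith
      _ = m ^ (-β) * π ^ (2 * β) * u ^ (-(2 * β)) := by
          rw [mul_rpow hm.le (by positivity), ← rpow_natCast, ← rpow_mul hup.le,
            div_rpow hu.1.le pi_pos.le]
          have : ((2 : ℕ) : ℝ) * -β = -(2 * β) := by push_cast; ring
          rw [this, rpow_neg pi_pos.le (2 * β), div_inv_eq_mul]
          ring
  have hneg : ∫ u in (-π)..0, (1 + m * sin (u / 2) ^ 2) ^ (-β) =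
      ∫ u in (0 : ℝ)..π, (1 + m * sin (u / 2) ^ 2) ^ (-β) := by
    have := intervalIntegral.integral_comp_neg (a := 0) (b := π)
      (fun u : ℝ => (1 + m * sin (u / 2) ^ 2) ^ (-β))
    simpa [neg_div] using this.symm
  rw [intervalIntegral.integral_const_mul, integral_rpow (Or.inl (by linarith)),
    zero_rpow (by linarith)] at hhalf
  rw [← intervalIntegral.integral_add_adjacent_intervals (hcont.intervalIntegrable _ 0)
    (hcont.intervalIntegrable _ _), hneg]
  have e : -(2 * β) + 1 = 1 - 2 * β := by ring
  rw [e, sub_zero] at hhalf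
  linarith

theorem exists_angle_mul_le_abs_sub {R r : ℝ} (hR : 0 < R) (hr : 0 < r) (c : ℝ) :
    ∃ φ : ℝ, ∀ ψ g : ℝ, 0 ≤ g → g ^ 2 = R ^ 2 + r ^ 2 - 2 * R * r * cos ψ →
      min R r * min (sin ((ψ + φ) / 2) ^ 2) (sin ((ψ - φ) / 2) ^ 2) ≤ |c - g| := by
  set d := max |R - r| (min c (R + r)) with hd
  have hlohi : |R - r| ≤ R + r := abs_le.2 ⟨by linarith, by linarith⟩
  have hd1 : |R - r| ≤ d := le_max_left _ _
  have hd2 : d ≤ R + r := max_le hlohi (min_le_right _ _)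
  have hd0 : 0 ≤ d := (abs_nonneg _).trans hd1
  have hRr : 0 < 2 * R * r := by positivity
  have hdl : (R - r) ^ 2 ≤ d ^ 2 := by rw [← sq_abs]; gcongr
  have hdu : d ^ 2 ≤ (R + r) ^ 2 := by gcongr
  have hcos : 2 * R * r * cos (arccos ((R ^ 2 + r ^ 2 - d ^ 2) / (2 * R * r))) =
      R ^ 2 + r ^ 2 - d ^ 2 := by
    rw [cos_arccos]
    · field_simp
    · rw [le_div_iff₀ hRr]; nlinarith
    · rw [div_le_iff₀ hRr]; nlinarith
  generalize arccos ((R ^ 2 + r ^ 2 - d ^ 2) / (2 * R * r)) = φ at hcos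
  refine ⟨φ, fun ψ g hg hg2 => ?_⟩
  have hgl : |R - r| ≤ g := by
    refine abs_le_of_sq_le_sq ?_ hg
    nlinarith [cos_le_one ψ]
  have hgu : g ≤ R + r := by
    refine (sq_le_sq₀ hg (by positivity)).1 ?_
    nlinarith [neg_one_le_cos ψ]
  have hclip : |d - g| ≤ |c - g| := by
    rw [hd]
    rcases le_total c (R + r) with h1 | h1
    · rw [min_eq_left h1]
      rcases le_total |R - r| c with h2 | h2
      · rw [max_eq_right h2]
      · rw [max_eq_left h2, abs_of_nonpos (sub_nonpos.2 hgl),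
          abs_of_nonpos (sub_nonpos.2 (h2.trans hgl))]
        linarith
    · rw [min_eq_right h1, max_eq_right hlohi, abs_of_nonneg (by linarith),
        abs_of_nonneg (by linarith)]; linarith
  refine le_trans ?_ hclip
  set p := |sin ((ψ + φ) / 2)| with hp
  set q := |sin ((ψ - φ) / 2)| with hq
  have hpq : |cos φ - cos ψ| = 2 * (p * q) := by
    rw [abs_sub_comm, cos_sub_cos, abs_mul, abs_mul, ← hp, ← hq]
    norm_num
    ring
  have hmin : min (sin ((ψ + φ) / 2) ^ 2) (sin ((ψ - φ) / 2) ^ 2) ≤ p * q := by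
    rw [← sq_abs, ← sq_abs (sin ((ψ - φ) / 2)), ← hp, ← hq]
    have hp0 : 0 ≤ p := abs_nonneg _
    have hq0 : 0 ≤ q := abs_nonneg _
    rcases le_total p q with h | h
    · exact (min_le_left _ _).trans (by nlinarith)
    · exact (min_le_right _ _).trans (by nlinarith)
  have hprod : |d - g| * (d + g) = 2 * R * r * (2 * (p * q)) := by
    calc |d - g| * (d + g) = |(d - g) * (d + g)| := by
          rw [abs_mul, abs_of_nonneg (add_nonneg hd0 hg)]
      _ = |2 * R * r * (cos ψ - cos φ)| := by congr 1; linarith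
      _ = 2 * R * r * (2 * (p * q)) := by rw [abs_mul, abs_of_pos hRr, abs_sub_comm, hpq]
  have hminmul : min R r * (R + r) ≤ 2 * R * r := by
    rcases le_total R r with h | h
    · rw [min_eq_left h]; nlinarith
    · rw [min_eq_right h]; nlinarith
  have hpq0 : 0 ≤ p * q := by positivity
  have hS : 0 < R + r := by positivity
  have h1 : min R r * (p * q) * (R + r) ≤ |d - g| * (R + r) := by
    have : |d - g| * (d + g) ≤ |d - g| * (2 * (R + r)) := by gcongr; linarith
    nlinarith
  calc _ ≤ min R r * (p * q) := by gcongr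
    _ ≤ _ := le_of_mul_le_mul_right h1 hS

theorem exists_setLIntegral_angle_le {β : ℝ} (hβ0 : 0 ≤ β) (hβ : β < 1 / 2) :
    ∃ K : ℝ, 0 ≤ K ∧ ∀ R r : ℝ, 0 < R → 0 < r → ∀ (c θ₀ : ℝ) (g : ℝ → ℝ), (∀ θ, 0 ≤ g θ) →
      (∀ θ, g θ ^ 2 = R ^ 2 + r ^ 2 - 2 * R * r * cos (θ - θ₀)) →
      ∫⁻ θ in Set.Ioo (-π) π, ENNReal.ofReal ((1 + |c - g θ|) ^ (-β)) ≤
        ENNReal.ofReal (K * min 1 (min R r ^ (-β))) := by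
  set K₀ := 2 * (π ^ (2 * β) * (π ^ (1 - 2 * β) / (1 - 2 * β)))
  have hK₀0 : 0 ≤ K₀ := by
    have : 0 < 1 - 2 * β := by linarith
    positivity
  refine ⟨2 * max (2 * π) K₀, by positivity, fun R r hR hr c θ₀ g hg0 hg => ?_⟩
  obtain ⟨φ, hφ⟩ := exists_angle_mul_le_abs_sub hR hr c
  set m := min R r with hm
  have hm0 : 0 < m := lt_min hR hr
  let h : ℝ → ℝ := fun u => (1 + m * sin (u / 2) ^ 2) ^ (-β)
  have hcont : Continuous h := by
    refine Continuous.rpow_const (by fun_prop) fun u => Or.inl ?_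
    positivity
  have hper : Function.Periodic h (2 * π) := fun u => by
    simp only [h]
    rw [add_div, mul_div_cancel_left₀ _ (two_ne_zero), sin_add_pi, neg_sq]
  have h0 : ∀ u, 0 ≤ h u := fun u => by positivity
  have hshift : ∀ s, ∫ θ in (-π)..π, h (θ + s) = ∫ u in (-π)..π, h u := fun s => by
    rw [intervalIntegral.integral_comp_add_right]
    have := hper.intervalIntegral_add_eq (-π + s) (-π)
    convert this using 2 <;> ring
  have hint : ∫ u in (-π)..π, h u ≤ max (2 * π) K₀ * min 1 (m ^ (-β)) := by
    rw [mul_min_of_nonneg _ _ (by positivity), mul_one]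
    refine le_min (le_max_of_le_left ?_) ?_
    · calc ∫ u in (-π)..π, h u ≤ ∫ u in (-π)..π, (1 : ℝ) := by
            refine intervalIntegral.integral_mono_on (by linarith [pi_pos])
              (hcont.intervalIntegrable _ _) (by simp) fun u _ => ?_
            refine rpow_le_one_of_one_le_of_nonpos ?_ (by linarith)
            have : 0 ≤ m * sin (u / 2) ^ 2 := by positivity
            linarith
        _ = 2 * π := by simp; ring
    · refine (integral_one_add_mul_sin_sq_rpow_le hβ0 hβ hm0).trans ?_
      gcongr
      exact le_max_right _ _
  have hpt : ∀ θ, (1 + |c - g θ|) ^ (-β) ≤ h (θ + (φ - θ₀)) + h (θ + (-φ - θ₀)) := fun θ => by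
    have key := hφ (θ - θ₀) (g θ) (hg0 θ) (hg θ)
    have e1 : θ - θ₀ + φ = θ + (φ - θ₀) := by ring
    have e2 : θ - θ₀ - φ = θ + (-φ - θ₀) := by ring
    rw [e1, e2] at key
    rcases min_choice (sin ((θ + (φ - θ₀)) / 2) ^ 2) (sin ((θ + (-φ - θ₀)) / 2) ^ 2) with e | e
    · rw [e] at key
      refine le_add_of_le_of_nonneg ?_ (h0 _)
      exact rpow_le_rpow_of_nonpos (by positivity) (by linarith) (by linarith)
    · rw [e] at key
      refine le_add_of_nonneg_of_le (h0 _) ?_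
      exact rpow_le_rpow_of_nonpos (by positivity) (by linarith) (by linarith)
  have hci : ∀ s, IntervalIntegrable (fun θ => h (θ + s)) volume (-π) π := fun s =>
    (hcont.comp (continuous_add_const s)).intervalIntegrable _ _
  have hππ : -π ≤ π := by linarith [pi_pos]
  calc ∫⁻ θ in Set.Ioo (-π) π, ENNReal.ofReal ((1 + |c - g θ|) ^ (-β))
      ≤ ∫⁻ θ in Set.Ioc (-π) π, ENNReal.ofReal (h (θ + (φ - θ₀)) + h (θ + (-φ - θ₀))) :=
        lintegral_mono' (Measure.restrict_mono Set.Ioo_subset_Ioc_self le_rfl)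
          fun θ => ENNReal.ofReal_le_ofReal (hpt θ)
    _ = ENNReal.ofReal (∫ θ in (-π)..π, (h (θ + (φ - θ₀)) + h (θ + (-φ - θ₀)))) := by
        rw [intervalIntegral.integral_of_le hππ, ofReal_integral_eq_lintegral_ofReal]
        · exact ((intervalIntegrable_iff_integrableOn_Ioc_of_le hππ).1 ((hci _).add (hci _)))
        · exact Filter.Eventually.of_forall fun θ => add_nonneg (h0 _) (h0 _)
    _ ≤ _ := by
        refine ENNReal.ofReal_le_ofReal ?_
        rw [intervalIntegral.integral_add (hci _) (hci _), hshift, hshift]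
        linarith

theorem setLIntegral_Ioc_rpow_s17 {a b s : ℝ} (ha : 0 ≤ a) (hab : a ≤ b) (h : -1 < s ∨ 0 < a) :
    ∫⁻ r in Set.Ioc a b, ENNReal.ofReal (r ^ s) = ENNReal.ofReal (∫ r in a..b, r ^ s) := by
  rw [intervalIntegral.integral_of_le hab, ofReal_integral_eq_lintegral_ofReal]
  · rw [← IntegrableOn, ← intervalIntegrable_iff_integrableOn_Ioc_of_le hab]
    rcases h with h | h
    · exact intervalIntegral.intervalIntegrable_rpow' h
    · refine intervalIntegral.intervalIntegrable_rpow (Or.inr ?_)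
      rw [Set.uIcc_of_le hab]
      exact fun h' => h.not_ge h'.1
  · filter_upwards [ae_restrict_mem measurableSet_Ioc] with r hr
    exact rpow_nonneg (ha.trans hr.1.le) _

theorem exists_integral_rpow_le {α β : ℝ} (hα : α < 2) (hβ : β ≤ 2 - α) :
    ∃ C : ℝ, 0 ≤ C ∧ ∀ R : ℝ, 2 ≤ R →
      1 / (2 - α) + ∫ r in (1 : ℝ)..R, r ^ (1 - α - β) ≤
        C * R ^ (2 - α - β) * (if 2 - α = β then log R else 1) := by
  have hα' : 0 < 2 - α := by linarith
  split_ifs with hif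
  · have hl2 : 0 < log 2 := log_pos one_lt_two
    refine ⟨1 / (2 - α) / log 2 + 1, by positivity, fun R hR => ?_⟩
    have e1 : 1 - α - β = -1 := by linarith
    have e2 : 2 - α - β = 0 := by linarith
    simp_rw [e1, e2, rpow_neg_one]
    rw [integral_inv_of_pos one_pos (by linarith), div_one, rpow_zero, mul_one, add_mul, one_mul]
    have hlog : log 2 ≤ log R := log_le_log two_pos hR
    gcongr
    calc 1 / (2 - α) = 1 / (2 - α) / log 2 * log 2 := by field_simp
      _ ≤ _ := by gcongr
  · have hd : 0 < 2 - α - β := by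
      have := lt_of_le_of_ne hβ (Ne.symm hif)
      linarith
    refine ⟨1 / (2 - α) + 1 / (2 - α - β), by positivity, fun R hR => ?_⟩
    have h1 : 1 ≤ R ^ (2 - α - β) := one_le_rpow (by linarith) hd.le
    rw [integral_rpow (Or.inl (by linarith)), one_rpow, mul_one, add_mul]
    have e : 1 - α - β + 1 = 2 - α - β := by ring
    rw [e]
    refine add_le_add (le_mul_of_one_le_right (by positivity) h1) ?_
    rw [one_div_mul_eq_div]
    gcongr
    linarith

theorem exists_setLIntegral_radius_le {α β : ℝ} (hα1 : 3 / 2 < α) (hα2 : α < 2)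
    (hβ1 : β ≤ 2 - α) :
    ∃ C : ℝ, 0 ≤ C ∧ ∀ R : ℝ, 2 ≤ R →
      ∫⁻ r in Set.Ioi (0 : ℝ),
          ENNReal.ofReal (r ^ (1 - α) * max R r ^ (-α) * min 1 (min R r ^ (-β))) ≤
        ENNReal.ofReal (C * R ^ (2 - 2 * α - β) * (if 2 - α = β then log R else 1)) := by
  obtain ⟨C, hC0, hC⟩ := exists_integral_rpow_le hα2 hβ1
  have hl2 : 0 < log 2 := log_pos one_lt_two
  have hα' : 0 < 2 * α - 2 := by linarith
  refine ⟨C + 1 / (2 * α - 2) * max 1 (1 / log 2), by positivity, fun R hR => ?_⟩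
  have hR0 : 0 < R := by linarith
  set L := if 2 - α = β then log R else 1 with hL
  have hL1 : 1 ≤ max 1 (1 / log 2) * L := by
    rw [hL]
    split_ifs
    · have hlog : log 2 ≤ log R := log_le_log two_pos hR
      calc 1 = 1 / log 2 * log 2 := by field_simp
        _ ≤ _ := by gcongr; exact le_max_right _ _
    · simp
  have hinner : ∫⁻ r in Set.Ioc 0 1,
      ENNReal.ofReal (r ^ (1 - α) * max R r ^ (-α) * min 1 (min R r ^ (-β))) ≤
        ENNReal.ofReal (R ^ (-α) * (1 / (2 - α))) := by
    calc _ ≤ ∫⁻ r in Set.Ioc (0 : ℝ) 1, ENNReal.ofReal (R ^ (-α)) * ENNReal.ofReal (r ^ (1 - α)) := by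
          refine setLIntegral_mono' measurableSet_Ioc fun r hr => ?_
          have hr0 := hr.1
          rw [← ENNReal.ofReal_mul (by positivity), max_eq_left (by linarith [hr.2])]
          refine ENNReal.ofReal_le_ofReal ?_
          rw [mul_comm (R ^ (-α))]
          exact mul_le_of_le_one_right (by positivity) (min_le_left _ _)
      _ = _ := by
          rw [lintegral_const_mul' _ _ ENNReal.ofReal_ne_top,
            setLIntegral_Ioc_rpow_s17 le_rfl zero_le_one (Or.inl (by linarith)),
            ← ENNReal.ofReal_mul (by positivity), integral_rpow (Or.inl (by linarith)), one_rpow,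
            zero_rpow (by linarith), sub_zero]
          congr 3
          ring
  have hmid : ∫⁻ r in Set.Ioc 1 R,
      ENNReal.ofReal (r ^ (1 - α) * max R r ^ (-α) * min 1 (min R r ^ (-β))) ≤
        ENNReal.ofReal (R ^ (-α) * ∫ r in (1 : ℝ)..R, r ^ (1 - α - β)) := by
    calc _ ≤ ∫⁻ r in Set.Ioc (1 : ℝ) R,
            ENNReal.ofReal (R ^ (-α)) * ENNReal.ofReal (r ^ (1 - α - β)) := by
          refine setLIntegral_mono' measurableSet_Ioc fun r hr => ?_
          have hr0 : 0 < r := one_pos.trans hr.1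
          rw [← ENNReal.ofReal_mul (by positivity), max_eq_left hr.2, min_eq_right hr.2]
          refine ENNReal.ofReal_le_ofReal ?_
          rw [sub_eq_add_neg _ β, rpow_add hr0, ← mul_assoc, mul_comm (R ^ (-α))]
          gcongr
          exact min_le_right _ _
      _ = _ := by
          rw [lintegral_const_mul' _ _ ENNReal.ofReal_ne_top,
            setLIntegral_Ioc_rpow_s17 zero_le_one (by linarith) (Or.inr one_pos),
            ← ENNReal.ofReal_mul (by positivity)]
  have houter : ∫⁻ r in Set.Ioi R,
      ENNReal.ofReal (r ^ (1 - α) * max R r ^ (-α) * min 1 (min R r ^ (-β))) ≤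
        ENNReal.ofReal (R ^ (-β) * (R ^ (2 - 2 * α) / (2 * α - 2))) := by
    calc _ ≤ ∫⁻ r in Set.Ioi R,
            ENNReal.ofReal (R ^ (-β)) * ENNReal.ofReal (r ^ (1 - 2 * α)) := by
          refine setLIntegral_mono' measurableSet_Ioi fun r hr => ?_
          have hr' : R < r := hr
          have hr0 : 0 < r := hR0.trans hr'
          rw [← ENNReal.ofReal_mul (by positivity), max_eq_right hr'.le, min_eq_left hr'.le]
          refine ENNReal.ofReal_le_ofReal ?_
          have e : 1 - 2 * α = 1 - α + -α := by ring
          rw [e, rpow_add hr0, mul_comm (R ^ (-β))]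
          gcongr
          exact min_le_right _ _
      _ = _ := by
          rw [lintegral_const_mul' _ _ ENNReal.ofReal_ne_top,
            ← ofReal_integral_eq_lintegral_ofReal
              (integrableOn_Ioi_rpow_of_lt (by linarith) hR0) ?_,
            ← ENNReal.ofReal_mul (by positivity), integral_Ioi_rpow_of_lt (by linarith) hR0]
          · congr 2
            have e : 1 - 2 * α + 1 = 2 - 2 * α := by ring
            rw [e, neg_div, ← div_neg, neg_sub]
          · filter_upwards [ae_restrict_mem measurableSet_Ioi] with r hr
            exact rpow_nonneg (hR0.trans hr).le _
  have hcover : Set.Ioi (0 : ℝ) = Set.Ioc 0 1 ∪ Set.Ioc 1 R ∪ Set.Ioi R := by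
    rw [Set.Ioc_union_Ioc_eq_Ioc zero_le_one (by linarith), Set.Ioc_union_Ioi_eq_Ioi hR0.le]
  have hI0 : 0 ≤ ∫ r in (1 : ℝ)..R, r ^ (1 - α - β) :=
    intervalIntegral.integral_nonneg (by linarith) fun r hr => rpow_nonneg (by linarith [hr.1]) _
  have hα'' : 0 < 2 - α := by linarith
  rw [hcover]
  refine (lintegral_union_le _ _ _).trans ((add_le_add ((lintegral_union_le _ _ _).trans
    (add_le_add hinner hmid)) houter).trans ?_)
  rw [← ENNReal.ofReal_add (by positivity) (by positivity),
    ← ENNReal.ofReal_add (by positivity) (by positivity)]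
  refine ENNReal.ofReal_le_ofReal ?_
  have e1 : R ^ (2 - 2 * α - β) = R ^ (-α) * R ^ (2 - α - β) := by
    rw [← rpow_add hR0]; congr 1; ring
  have e2 : R ^ (2 - 2 * α - β) = R ^ (-β) * R ^ (2 - 2 * α) := by
    rw [← rpow_add hR0]; congr 1; ring
  rw [← mul_add, add_mul, add_mul]
  refine add_le_add ?_ ?_
  · rw [e1]
    calc _ ≤ R ^ (-α) * (C * R ^ (2 - α - β) * L) := by gcongr; exact hC R hR
      _ = _ := by ring
  · calc _ = 1 / (2 * α - 2) * R ^ (2 - 2 * α - β) * 1 := by rw [e2]; ring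
      _ ≤ 1 / (2 * α - 2) * R ^ (2 - 2 * α - β) * (max 1 (1 / log 2) * L) := by gcongr
      _ = _ := by ring

theorem norm_sub_polarCoord_symm_sq (k : ℂ) (r θ : ℝ) :
    ‖k - Complex.polarCoord.symm (r, θ)‖ ^ 2 =
      ‖k‖ ^ 2 + r ^ 2 - 2 * ‖k‖ * r * cos (θ - k.arg) := by
  rw [Complex.polarCoord_symm_apply, Complex.sq_norm, Complex.normSq_apply, cos_sub]
  simp only [Complex.sub_re, Complex.sub_im, Complex.mul_re, Complex.mul_im, Complex.add_re,
    Complex.add_im, Complex.ofReal_re, Complex.ofReal_im, Complex.I_re, Complex.I_im]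
  rw [← Complex.norm_mul_cos_arg k, ← Complex.norm_mul_sin_arg k]
  linear_combination ‖k‖ ^ 2 * sin_sq_add_cos_sq k.arg + r ^ 2 * sin_sq_add_cos_sq θ

theorem exists_lintegral_rpow_max_le {α β : ℝ} (hα1 : 3 / 2 < α) (hα2 : α < 2) (hβ0 : 0 ≤ β)
    (hβ1 : β ≤ 2 - α) :
    ∃ C : ℝ, 0 ≤ C ∧ ∀ k : ℂ, 2 ≤ ‖k‖ → ∀ Y : ℝ,
      ∫⁻ z : ℂ, ENNReal.ofReal
          (‖z‖ ^ (-α) * max ‖k‖ ‖z‖ ^ (-α) * (1 + |Y - ‖z‖ - ‖k - z‖|) ^ (-β)) ≤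
        ENNReal.ofReal (C * ‖k‖ ^ (2 - 2 * α - β) * (if 2 - α = β then log ‖k‖ else 1)) := by
  obtain ⟨K, hK0, hK⟩ := exists_setLIntegral_angle_le hβ0 (by linarith : β < 1 / 2)
  obtain ⟨C, hC0, hC⟩ := exists_setLIntegral_radius_le hα1 hα2 hβ1
  refine ⟨K * C, by positivity, fun k hk Y => ?_⟩
  have hk0 : 0 < ‖k‖ := by linarith
  rw [← Complex.lintegral_comp_polarCoord_symm, polarCoord_target, Measure.volume_eq_prod,
    setLIntegral_prod]
  · calc _ ≤ ∫⁻ r in Set.Ioi (0 : ℝ), ENNReal.ofReal K *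
            ENNReal.ofReal (r ^ (1 - α) * max ‖k‖ r ^ (-α) * min 1 (min ‖k‖ r ^ (-β))) := by
          refine setLIntegral_mono' measurableSet_Ioi fun r hr => ?_
          have hr0 : 0 < r := hr
          calc _ = ∫⁻ θ in Set.Ioo (-π) π, ENNReal.ofReal (r ^ (1 - α) * max ‖k‖ r ^ (-α)) *
                  ENNReal.ofReal
                    ((1 + |Y - r - ‖k - Complex.polarCoord.symm (r, θ)‖|) ^ (-β)) := by
                refine lintegral_congr fun θ => ?_
                have hn : ‖Complex.polarCoord.symm (r, θ)‖ = r := by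
                  rw [Complex.norm_polarCoord_symm, abs_of_pos hr0]
                rw [hn, smul_eq_mul, ← ENNReal.ofReal_mul hr0.le,
                  ← ENNReal.ofReal_mul (by positivity), sub_eq_add_neg 1 α, rpow_add hr0,
                  rpow_one]
                congr 1
                ring
            _ = ENNReal.ofReal (r ^ (1 - α) * max ‖k‖ r ^ (-α)) * ∫⁻ θ in Set.Ioo (-π) π,
                  ENNReal.ofReal
                    ((1 + |Y - r - ‖k - Complex.polarCoord.symm (r, θ)‖|) ^ (-β)) :=
                lintegral_const_mul' _ _ ENNReal.ofReal_ne_top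
            _ ≤ ENNReal.ofReal (r ^ (1 - α) * max ‖k‖ r ^ (-α)) *
                  ENNReal.ofReal (K * min 1 (min ‖k‖ r ^ (-β))) := by
                gcongr
                exact hK ‖k‖ r hk0 hr0 (Y - r) k.arg _ (fun θ => norm_nonneg _)
                  fun θ => norm_sub_polarCoord_symm_sq k r θ
            _ = _ := by
                rw [← ENNReal.ofReal_mul (by positivity), ← ENNReal.ofReal_mul hK0]
                congr 1
                ring
      _ ≤ ENNReal.ofReal K * ENNReal.ofReal
            (C * ‖k‖ ^ (2 - 2 * α - β) * (if 2 - α = β then log ‖k‖ else 1)) := by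
          rw [lintegral_const_mul' _ _ ENNReal.ofReal_ne_top]
          gcongr
          exact hC _ hk
      _ = _ := by
          rw [← ENNReal.ofReal_mul hK0]
          congr 1
          ring
  · have hsymm : Measurable fun p : ℝ × ℝ => Complex.polarCoord.symm p := by
      simp_rw [Complex.polarCoord_symm_apply]
      fun_prop
    simp only [smul_eq_mul]
    fun_prop

theorem rpow_mul_rpow_le_of_norm_le {E : Type*} [NormedAddCommGroup E] {α : ℝ} (hα : 0 ≤ α)
    {k x : E} (hk : k ≠ 0) (h : ‖x‖ ≤ ‖k - x‖) :
    ‖x‖ ^ (-α) * ‖k - x‖ ^ (-α) ≤ 2 ^ α * (‖x‖ ^ (-α) * max ‖k‖ ‖x‖ ^ (-α)) := by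
  have hk0 : 0 < ‖k‖ := norm_pos_iff.2 hk
  have hM : 0 < max ‖k‖ ‖x‖ := lt_max_of_lt_left hk0
  have htri : ‖k‖ ≤ ‖k - x‖ + ‖x‖ := norm_le_norm_sub_add k x
  have hle : max ‖k‖ ‖x‖ / 2 ≤ ‖k - x‖ := by
    rw [div_le_iff₀ two_pos]
    exact max_le (by linarith) (by linarith [norm_nonneg (k - x)])
  have := rpow_le_rpow_of_nonpos (by positivity) hle (neg_nonpos.2 hα)
  rw [div_rpow hM.le two_pos.le, rpow_neg two_pos.le, div_inv_eq_mul] at this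
  calc _ ≤ ‖x‖ ^ (-α) * (max ‖k‖ ‖x‖ ^ (-α) * 2 ^ α) := by gcongr
    _ = _ := by ring

theorem exists_complex_lintegral_le {α β : ℝ} (hα1 : 3 / 2 < α) (hα2 : α < 2) (hβ0 : 0 ≤ β)
    (hβ1 : β ≤ 2 - α) :
    ∃ C : ℝ, 0 ≤ C ∧ ∀ k : ℂ, 2 ≤ ‖k‖ → ∀ Y : ℝ,
      ∫⁻ z : ℂ, ENNReal.ofReal
          (‖z‖ ^ (-α) * ‖k - z‖ ^ (-α) * (1 + |Y - ‖z‖ - ‖k - z‖|) ^ (-β)) ≤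
        ENNReal.ofReal (C * ‖k‖ ^ (2 - 2 * α - β) * (if 2 - α = β then log ‖k‖ else 1)) := by
  obtain ⟨C, hC0, hC⟩ := exists_lintegral_rpow_max_le hα1 hα2 hβ0 hβ1
  refine ⟨2 ^ α * (2 * C), by positivity, fun k hk Y => ?_⟩
  have hk0 : k ≠ 0 := norm_pos_iff.1 (by linarith)
  set G : ℂ → ENNReal := fun z => ENNReal.ofReal
    (‖z‖ ^ (-α) * max ‖k‖ ‖z‖ ^ (-α) * (1 + |Y - ‖z‖ - ‖k - z‖|) ^ (-β)) with hG
  have hpt : ∀ z, ‖z‖ ≤ ‖k - z‖ → ENNReal.ofReal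
      (‖z‖ ^ (-α) * ‖k - z‖ ^ (-α) * (1 + |Y - ‖z‖ - ‖k - z‖|) ^ (-β)) ≤
        ENNReal.ofReal (2 ^ α) * G z := fun z hz => by
    rw [hG, ← ENNReal.ofReal_mul (by positivity), ← mul_assoc (2 ^ α)]
    refine ENNReal.ofReal_le_ofReal ?_
    exact mul_le_mul_of_nonneg_right
      (rpow_mul_rpow_le_of_norm_le (by linarith) hk0 hz) (by positivity)
  have hGm : Measurable G := by fun_prop
  calc _ ≤ ∫⁻ z, ENNReal.ofReal (2 ^ α) * (G z + G (k - z)) := by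
        refine lintegral_mono fun z => ?_
        rw [mul_add]
        rcases le_total ‖z‖ ‖k - z‖ with h | h
        · exact (hpt z h).trans le_self_add
        · refine le_trans (le_of_eq ?_) ((hpt (k - z) (by simpa using h)).trans le_add_self)
          rw [sub_sub_cancel, mul_comm (‖z‖ ^ (-α)), sub_right_comm]
    _ = ENNReal.ofReal (2 ^ α) * (2 * ∫⁻ z, G z) := by
        rw [lintegral_const_mul' _ _ ENNReal.ofReal_ne_top, lintegral_add_left hGm,
          lintegral_sub_left_eq_self, two_mul]
    _ ≤ ENNReal.ofReal (2 ^ α) * (ENNReal.ofReal 2 * ENNReal.ofReal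
          (C * ‖k‖ ^ (2 - 2 * α - β) * (if 2 - α = β then log ‖k‖ else 1))) := by
        rw [ENNReal.ofReal_ofNat]
        gcongr
        exact hC k hk Y
    _ = _ := by
        rw [← ENNReal.ofReal_mul two_pos.le, ← ENNReal.ofReal_mul (by positivity)]
        congr 1
        ring

/-- Lemma (planar integral estimate, case `3/2 < α < 2`, `0 ≤ β ≤ 2−α`). -/
theorem planar_integral_estimate_two
    (α β : ℝ) (hα1 : 3 / 2 < α) (hα2 : α < 2) (hβ0 : 0 ≤ β) (hβ1 : β ≤ 2 - α) :
    ∃ C : ℝ, ∀ k : EuclideanSpace ℝ (Fin 2), 2 ≤ ‖k‖ → ∀ Y : ℝ,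
      (∫ x : EuclideanSpace ℝ (Fin 2),
          ‖x‖ ^ (-α) * ‖k - x‖ ^ (-α) * (1 + |Y - ‖x‖ - ‖k - x‖|) ^ (-β))
        ≤ C * ‖k‖ ^ (2 - 2 * α - β) * (if 2 - α = β then Real.log ‖k‖ else 1) := by
  obtain ⟨C, hC0, hC⟩ := exists_complex_lintegral_le hα1 hα2 hβ0 hβ1
  refine ⟨C, fun k hk Y => ?_⟩
  let e := Complex.orthonormalBasisOneI.repr.symm
  have hlog : 0 ≤ if 2 - α = β then Real.log ‖k‖ else 1 := by
    split_ifs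
    · exact log_nonneg (by linarith)
    · exact zero_le_one
  rw [integral_eq_lintegral_of_nonneg_ae (Filter.Eventually.of_forall fun x => by positivity)
    (by apply Measurable.aestronglyMeasurable; fun_prop)]
  refine ENNReal.toReal_le_of_le_ofReal (by positivity) ?_
  have h := hC (e k) (by rwa [e.norm_map]) Y
  rw [← e.measurePreserving.lintegral_comp_emb e.toHomeomorph.measurableEmbedding] at h
  simpa only [← map_sub, e.norm_map] using h
end
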